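/- arXiv:2012.05632 — 10 statements merged into one kernel-verified Lean document; each statement's English description precedes it below -/
import Mathlib

section
/- Let N, T be positive integers, let Γ ∈ ℝ^{N×N} be symmetric strictly positive definite, let β, τ, g, ε, η > 0 and set ρ = max_{i,j} |(Γ⁻¹ Γ⁻¹)_{i,j}|. Let K = {W ∈ ℝ^{N×N} : W symmetric strictly positive definite, max_{i,j} |W_{i,j}| ≤ β, and Tr(Γ W Γ) ≤ τ} and 𝓛 = {L ∈ ℝ^{N×N} : L symmetric positive semidefinite and ∑_{i,j} |L_{i,j}| ≤ g}. Suppose L_1, …, L_T ∈ 𝓛 and W_1, …, W_T ∈ K are such that for each t ∈ [T], W_t minimises the function W ↦ −ln det(Γ W Γ + ε E) + η ∑_{s=1}^{t−1} L_s • W over K. Then for every W* ∈ K, ∑_{t=1}^{T} (W_t − W*) • L_t ≤ τ/(ε η) + 1152 √e · g² (β + ρ ε)² η T. -/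
open Finset Matrix

/-- Frobenius inner product of two square real matrices. -/
noncomputable def frob {N : ℕ} (A B : Matrix (Fin N) (Fin N) ℝ) : ℝ :=
  ∑ i, ∑ j, A i j * B i j

open scoped MatrixOrder in
theorem exists_eq_conjTranspose_mul_self {N : ℕ} {A : Matrix (Fin N) (Fin N) ℝ}
    (hA : A.PosSemidef) : ∃ B : Matrix (Fin N) (Fin N) ℝ, A = Bᴴ * B :=
  CStarAlgebra.nonneg_iff_eq_star_mul_self.mp hA.nonneg

theorem trace_mul_nonneg {N : ℕ} {M X : Matrix (Fin N) (Fin N) ℝ}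
    (hM : M.PosSemidef) (hX : X.PosSemidef) : 0 ≤ (M * X).trace := by
  obtain ⟨B, hB⟩ := exists_eq_conjTranspose_mul_self hX
  have h := (hM.mul_mul_conjTranspose_same B).trace_nonneg
  rwa [Matrix.trace_mul_comm, ← Matrix.mul_assoc, ← hB, Matrix.trace_mul_comm] at h

/-- Minus the logarithm of the determinant dominates its tangent: `log det P ≤ Tr P - N`. -/
theorem log_det_le_trace_sub {N : ℕ} {P : Matrix (Fin N) (Fin N) ℝ} (hP : P.PosDef) :
    Real.log P.det ≤ P.trace - N := by
  have h1 := hP.isHermitian.det_eq_prod_eigenvalues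
  have h2 := hP.isHermitian.trace_eq_sum_eigenvalues
  simp only [RCLike.ofReal_real_eq_id, id] at h1 h2
  rw [h1, h2, Real.log_prod (fun i _ => (hP.eigenvalues_pos i).ne')]
  calc _ ≤ ∑ i, (hP.isHermitian.eigenvalues i - 1) :=
        Finset.sum_le_sum fun i _ => Real.log_le_sub_one_of_pos (hP.eigenvalues_pos i)
    _ = _ := by simp

theorem log_det_add_log_det_le {N : ℕ} {Z Y : Matrix (Fin N) (Fin N) ℝ}
    (hZ : Z.PosDef) (hY : Y.PosDef) :
    Real.log Z.det + Real.log Y.det ≤ (Z * Y).trace - N := by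
  obtain ⟨B, hB⟩ := exists_eq_conjTranspose_mul_self hY.posSemidef
  have hdet : B.det ≠ 0 := by
    intro h
    have := hY.det_pos
    rw [hB, Matrix.det_mul, h] at this
    simp at this
  have hP : (B * Z * Bᴴ).PosDef := by
    have hu : IsUnit B := (Matrix.isUnit_iff_isUnit_det _).mpr (isUnit_iff_ne_zero.mpr hdet)
    exact hZ.mul_mul_conjTranspose_same (Matrix.vecMul_injective_iff_isUnit.mpr hu)
  have h := log_det_le_trace_sub hP
  rw [← Real.log_mul hZ.det_pos.ne' hY.det_pos.ne']
  have e1 : (B * Z * Bᴴ).det = Z.det * Y.det := by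
    rw [hB]; simp only [Matrix.det_mul]; ring
  have e2 : (B * Z * Bᴴ).trace = (Z * Y).trace := by
    rw [hB, Matrix.trace_mul_comm, ← Matrix.mul_assoc, Matrix.trace_mul_comm]
  rwa [e1, e2] at h

theorem one_add_trace_le_det_one_add {N : ℕ} {Q : Matrix (Fin N) (Fin N) ℝ} (hQ : Q.PosSemidef) :
    1 + Q.trace ≤ (1 + Q).det := by
  have h2 := hQ.isHermitian.trace_eq_sum_eigenvalues
  simp only [RCLike.ofReal_real_eq_id, id] at h2
  have h1 : (1 + Q).det = ∏ i, (1 + hQ.isHermitian.eigenvalues i) := by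
    have h := congrArg (Polynomial.eval (-1)) hQ.isHermitian.charpoly_eq
    rw [Matrix.eval_charpoly, Polynomial.eval_prod] at h
    have e : Matrix.scalar (Fin N) (-1 : ℝ) - Q = -(1 + Q) := by
      rw [map_neg, map_one, neg_add, sub_eq_add_neg]
    rw [e, Matrix.det_neg] at h
    have e' : ∀ x : ℝ, -1 - x = -1 * (1 + x) := fun x => by ring
    simp only [Polynomial.eval_sub, Polynomial.eval_X, Polynomial.eval_C,
      RCLike.ofReal_real_eq_id, id, e', Finset.prod_mul_distrib, Finset.prod_const,
      Finset.card_univ] at h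
    exact mul_left_cancel₀ (pow_ne_zero _ (by norm_num)) h
  rw [h1, h2]
  have key : ∀ s : Finset (Fin N), 1 + ∑ i ∈ s, hQ.isHermitian.eigenvalues i
      ≤ ∏ i ∈ s, (1 + hQ.isHermitian.eigenvalues i) := by
    intro s
    induction s using Finset.induction_on with
    | empty => simp
    | insert a s ha ih =>
      rw [Finset.sum_insert ha, Finset.prod_insert ha]
      have h0 := hQ.eigenvalues_nonneg a
      have h3 : 0 ≤ ∑ i ∈ s, hQ.isHermitian.eigenvalues i :=
        Finset.sum_nonneg fun i _ => hQ.eigenvalues_nonneg i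
      nlinarith
  exact key _

theorem one_add_trace_mul_le_det {N : ℕ} {X M : Matrix (Fin N) (Fin N) ℝ}
    (hX : X.PosSemidef) (hM : M.PosSemidef) :
    1 + (M * X).trace ≤ (1 + M * X).det := by
  obtain ⟨B, hB⟩ := exists_eq_conjTranspose_mul_self hX
  have h := one_add_trace_le_det_one_add (hM.mul_mul_conjTranspose_same B)
  have e1 : (1 + B * M * Bᴴ).det = (1 + M * X).det := by
    rw [hB, Matrix.mul_assoc, Matrix.det_one_add_mul_comm, Matrix.mul_assoc]
  have e2 : (B * M * Bᴴ).trace = (M * X).trace := by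
    rw [hB, Matrix.trace_mul_comm, ← Matrix.mul_assoc, Matrix.trace_mul_comm]
  rwa [e1, e2] at h

theorem sub_sq_div_two_le_log_one_add {x : ℝ} (hx : 0 ≤ x) : x - x ^ 2 / 2 ≤ Real.log (1 + x) := by
  refine le_trans ?_ (Real.le_log_one_add_of_nonneg hx)
  rw [le_div_iff₀ (by linarith)]
  nlinarith [pow_nonneg hx 3]

/-- The log-determinant Bregman divergence absorbs a positive semidefinite linear loss. -/
theorem neg_sq_le_logDet_bregman_add {N : ℕ} {X Y M : Matrix (Fin N) (Fin N) ℝ}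
    (hX : X.PosDef) (hY : Y.PosDef) (hM : M.PosSemidef) :
    -((M * X).trace ^ 2 / 2) ≤ (X⁻¹ * (Y - X)).trace - Real.log Y.det + Real.log X.det
      + (M * (Y - X)).trace := by
  have hu : IsUnit X.det := hX.det_pos.ne'.isUnit
  have hZ : (X⁻¹ + M).PosDef := hX.inv.add_posSemidef hM
  have h1 := log_det_add_log_det_le hZ hY
  have h2 := one_add_trace_mul_le_det hX.posSemidef hM
  have h0 := trace_mul_nonneg hM hX.posSemidef
  have h3 : Real.log (X⁻¹ + M).det + Real.log X.det = Real.log (1 + M * X).det := by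
    rw [← Real.log_mul hZ.det_pos.ne' hX.det_pos.ne', ← Matrix.det_mul, Matrix.add_mul,
      Matrix.nonsing_inv_mul _ hu]
  have h4 := Real.log_le_log (by linarith) h2
  have h5 := sub_sq_div_two_le_log_one_add h0
  have e1 : (X⁻¹ * (Y - X)).trace = (X⁻¹ * Y).trace - N := by
    rw [Matrix.mul_sub, Matrix.nonsing_inv_mul _ hu, Matrix.trace_sub]; simp
  rw [e1, Matrix.mul_sub, Matrix.trace_sub]
  rw [Matrix.add_mul, Matrix.trace_add] at h1
  linarith

theorem trace_inv_mul_sub_le_of_isMin {N : ℕ} {X Y : Matrix (Fin N) (Fin N) ℝ}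
    (hX : X.PosDef) (hY : Y.PosDef) {b : ℝ}
    (h : ∀ s ∈ Set.Ioo (0 : ℝ) 1,
      -Real.log X.det ≤ -Real.log (X + s • (Y - X)).det + s * b) :
    (X⁻¹ * (Y - X)).trace ≤ b := by
  have hdet : Continuous fun s : ℝ => (X + s • (Y - X)).det := by fun_prop
  have hinv : ContinuousAt (fun s : ℝ => ((X + s • (Y - X))⁻¹ * (Y - X)).trace) 0 := by
    simp only [Matrix.inv_def, Ring.inverse_eq_inv']
    have ha : Continuous fun s : ℝ => (X + s • (Y - X)).adjugate :=
      Continuous.matrix_adjugate (by fun_prop)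
    have hd : ContinuousAt (fun s : ℝ => ((X + s • (Y - X)).det)⁻¹) 0 :=
      hdet.continuousAt.inv₀ (by simpa using hX.det_pos.ne')
    have hc : ContinuousAt (fun s : ℝ => ((X + s • (Y - X)).det)⁻¹ •
        ((X + s • (Y - X)).adjugate * (Y - X)).trace) 0 :=
      hd.smul (ha.matrix_mul continuous_const).matrix_trace.continuousAt
    simpa only [Matrix.smul_mul, Matrix.trace_smul] using hc
  have ht : Filter.Tendsto (fun s : ℝ => ((X + s • (Y - X))⁻¹ * (Y - X)).trace)
      (nhdsWithin 0 (Set.Ioi 0)) (nhds (X⁻¹ * (Y - X)).trace) := by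
    have := hinv.tendsto.mono_left (nhdsWithin_le_nhds (s := Set.Ioi 0))
    simpa using this
  refine le_of_tendsto ht ?_
  filter_upwards [Ioo_mem_nhdsGT (zero_lt_one : (0 : ℝ) < 1)] with s hs
  have hP : (X + s • (Y - X)).PosDef := by
    have : X + s • (Y - X) = (1 - s) • X + s • Y := by module
    rw [this]
    exact (hX.smul (by linarith [hs.2])).add (hY.smul hs.1)
  have h1 := log_det_add_log_det_le hP.inv hX
  have hu : IsUnit (X + s • (Y - X)).det := hP.det_pos.ne'.isUnit
  have h2 : ((X + s • (Y - X))⁻¹ * X).trace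
      = N - s * ((X + s • (Y - X))⁻¹ * (Y - X)).trace := by
    have e : X = (X + s • (Y - X)) - s • (Y - X) := by simp
    have e2 : (X + s • (Y - X))⁻¹ * X = 1 - s • ((X + s • (Y - X))⁻¹ * (Y - X)) := by
      conv_lhs => rhs; rw [e]
      rw [Matrix.mul_sub, Matrix.nonsing_inv_mul _ hu, Matrix.mul_smul]
    rw [e2, Matrix.trace_sub, Matrix.trace_smul]; simp
  have h3 : Real.log ((X + s • (Y - X))⁻¹).det = -Real.log (X + s • (Y - X)).det := by
    rw [Matrix.det_nonsing_inv, Ring.inverse_eq_inv', Real.log_inv]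
  have h4 := h s hs
  rw [h2, h3] at h1
  have : s * ((X + s • (Y - X))⁻¹ * (Y - X)).trace ≤ s * b := by linarith
  exact le_of_mul_le_mul_left this hs.1

theorem frob_eq_trace {N : ℕ} (A B : Matrix (Fin N) (Fin N) ℝ) : frob A B = (Aᵀ * B).trace := by
  simp only [frob, Matrix.trace, Matrix.diag, Matrix.mul_apply, Matrix.transpose_apply]
  exact Finset.sum_comm

theorem frob_comm {N : ℕ} (A B : Matrix (Fin N) (Fin N) ℝ) : frob A B = frob B A := by
  simp [frob, mul_comm]

theorem frob_sub_right {N : ℕ} (A B C : Matrix (Fin N) (Fin N) ℝ) :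
    frob A (B - C) = frob A B - frob A C := by
  simp [frob, mul_sub, Finset.sum_sub_distrib]

theorem frob_add_smul_sub_right {N : ℕ} (A B C : Matrix (Fin N) (Fin N) ℝ) (s : ℝ) :
    frob A (B + s • (C - B)) = frob A B + s * (frob A C - frob A B) := by
  simp only [frob_eq_trace, Matrix.mul_add, Matrix.trace_add, Matrix.mul_smul, Matrix.trace_smul,
    Matrix.mul_sub, Matrix.trace_sub, smul_eq_mul]

theorem frob_le_mul_of_abs_le {N : ℕ} {A B : Matrix (Fin N) (Fin N) ℝ} {g c : ℝ}
    (hc : 0 ≤ c) (hA : ∑ i, ∑ j, |A i j| ≤ g) (hB : ∀ i j, |B i j| ≤ c) : frob A B ≤ g * c := by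
  calc frob A B ≤ ∑ i, ∑ j, |A i j| * c := by
        refine Finset.sum_le_sum fun i _ => Finset.sum_le_sum fun j _ => ?_
        exact (le_abs_self _).trans (by
          rw [abs_mul]; exact mul_le_mul_of_nonneg_left (hB i j) (abs_nonneg _))
    _ = (∑ i, ∑ j, |A i j|) * c := by simp only [Finset.sum_mul]
    _ ≤ g * c := mul_le_mul_of_nonneg_right hA hc

theorem posDef_conj_add_smul_one {N : ℕ} {Γ V : Matrix (Fin N) (Fin N) ℝ} {ε : ℝ}
    (hΓ : Γ.IsHermitian) (hε : 0 < ε) (hV : V.PosDef) :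
    (Γ * V * Γ + ε • (1 : Matrix (Fin N) (Fin N) ℝ)).PosDef := by
  have h := hV.posSemidef.mul_mul_conjTranspose_same Γ
  rw [hΓ.eq] at h
  exact (Matrix.PosDef.one.smul hε).posSemidef_add h

theorem trace_conj_inv_mul {N : ℕ} {Γ : Matrix (Fin N) (Fin N) ℝ} (hΓ : Γ.PosDef)
    {L : Matrix (Fin N) (Fin N) ℝ} (hL : L.PosSemidef) (A : Matrix (Fin N) (Fin N) ℝ) :
    (Γ⁻¹ * L * Γ⁻¹ * (Γ * A * Γ)).trace = frob L A := by
  have hu : IsUnit Γ.det := hΓ.det_pos.ne'.isUnit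
  have hLt : Lᵀ = L := by simpa using hL.isHermitian.eq
  have e : Γ⁻¹ * L * Γ⁻¹ * (Γ * A * Γ) = Γ⁻¹ * (L * A * Γ) := by
    simp only [Matrix.mul_assoc]
    rw [Matrix.nonsing_inv_mul_cancel_left _ _ hu]
  rw [e, Matrix.trace_mul_comm, Matrix.mul_nonsing_inv_cancel_right _ _ hu, frob_eq_trace, hLt]

theorem trace_conj_inv_mul_add_smul_one {N : ℕ} {Γ : Matrix (Fin N) (Fin N) ℝ} (hΓ : Γ.PosDef)
    {L : Matrix (Fin N) (Fin N) ℝ} (hL : L.PosSemidef) (A : Matrix (Fin N) (Fin N) ℝ) (ε : ℝ) :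
    (Γ⁻¹ * L * Γ⁻¹ * (Γ * A * Γ + ε • (1 : Matrix (Fin N) (Fin N) ℝ))).trace
      = frob L A + ε * frob L (Γ⁻¹ * Γ⁻¹) := by
  have hLt : Lᵀ = L := by simpa using hL.isHermitian.eq
  rw [Matrix.mul_add, Matrix.trace_add, trace_conj_inv_mul hΓ hL, Matrix.mul_smul,
    Matrix.trace_smul, Matrix.mul_one, smul_eq_mul, frob_eq_trace L (Γ⁻¹ * Γ⁻¹), hLt,
    Matrix.mul_assoc, Matrix.trace_mul_comm, Matrix.mul_assoc]

/-- Stability of a minimiser of a linearly perturbed log-determinant regularizer when one more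
positive semidefinite loss is added. -/
theorem ftrl_logDet_stability {N : ℕ} {Γ W V L : Matrix (Fin N) (Fin N) ℝ} {ε η b c : ℝ}
    (hΓ : Γ.PosDef) (hε : 0 < ε) (hη : 0 < η) (hW : W.PosDef) (hV : V.PosDef)
    (hL : L.PosSemidef)
    (hc : frob L W + ε * frob L (Γ⁻¹ * Γ⁻¹) ≤ c)
    (h : ∀ s ∈ Set.Ioo (0 : ℝ) 1,
      -Real.log (Γ * W * Γ + ε • (1 : Matrix (Fin N) (Fin N) ℝ)).det
        ≤ -Real.log (Γ * (W + s • (V - W)) * Γ + ε • (1 : Matrix (Fin N) (Fin N) ℝ)).det + s * b) :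
    -Real.log (Γ * W * Γ + ε • (1 : Matrix (Fin N) (Fin N) ℝ)).det + η * frob L W
        - η ^ 2 * (c ^ 2 / 2)
      ≤ -Real.log (Γ * V * Γ + ε • (1 : Matrix (Fin N) (Fin N) ℝ)).det + b + η * frob L V := by
  have hX := posDef_conj_add_smul_one hΓ.isHermitian hε hW
  have hY := posDef_conj_add_smul_one hΓ.isHermitian hε hV
  set X := Γ * W * Γ + ε • (1 : Matrix (Fin N) (Fin N) ℝ) with hXdef
  set Y := Γ * V * Γ + ε • (1 : Matrix (Fin N) (Fin N) ℝ) with hYdef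
  have hXY : Y - X = Γ * (V - W) * Γ := by
    rw [hXdef, hYdef, Matrix.mul_sub, Matrix.sub_mul]; abel
  have h1 : (X⁻¹ * (Y - X)).trace ≤ b := by
    refine trace_inv_mul_sub_le_of_isMin hX hY fun s hs => ?_
    have e : X + s • (Y - X) = Γ * (W + s • (V - W)) * Γ
        + ε • (1 : Matrix (Fin N) (Fin N) ℝ) := by
      rw [hXY, hXdef, Matrix.mul_add, Matrix.add_mul, Matrix.mul_smul, Matrix.smul_mul]; abel
    rw [e]
    exact h s hs
  have hM : (Γ⁻¹ * L * Γ⁻¹).PosSemidef := by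
    have := hL.mul_mul_conjTranspose_same Γ⁻¹
    rwa [hΓ.inv.isHermitian.eq] at this
  have h2 := neg_sq_le_logDet_bregman_add hX hY (hM.smul hη.le)
  have h3 := trace_mul_nonneg hM hX.posSemidef
  rw [Matrix.smul_mul, Matrix.trace_smul, Matrix.smul_mul, Matrix.trace_smul, hXY,
    trace_conj_inv_mul hΓ hL, ← hXY, frob_sub_right] at h2
  have h4 : (Γ⁻¹ * L * Γ⁻¹ * X).trace ≤ c := by
    rw [hXdef, trace_conj_inv_mul_add_smul_one hΓ hL]; exact hc
  have h5 := pow_le_pow_left₀ h3 h4 2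
  have h6 := mul_le_mul_of_nonneg_left h5 (sq_nonneg η)
  simp only [smul_eq_mul, mul_pow] at h2
  linarith

theorem neg_log_det_sub_le_trace_div {N : ℕ} {A B : Matrix (Fin N) (Fin N) ℝ} {ε : ℝ} (hε : 0 < ε)
    (hA : A.PosSemidef) (hB : B.PosSemidef) :
    -Real.log (A + ε • (1 : Matrix (Fin N) (Fin N) ℝ)).det
      ≤ -Real.log (B + ε • (1 : Matrix (Fin N) (Fin N) ℝ)).det + B.trace / ε := by
  have key : ∀ C : Matrix (Fin N) (Fin N) ℝ, C.PosSemidef →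
      Real.log (C + ε • (1 : Matrix (Fin N) (Fin N) ℝ)).det
        = N * Real.log ε + Real.log (1 + ε⁻¹ • C).det ∧ (1 + ε⁻¹ • C).PosDef := by
    intro C hC
    have hP : (1 + ε⁻¹ • C).PosDef :=
      Matrix.PosDef.one.add_posSemidef (hC.smul (inv_nonneg.mpr hε.le))
    have e : C + ε • (1 : Matrix (Fin N) (Fin N) ℝ) = ε • (1 + ε⁻¹ • C) := by
      rw [smul_add, smul_smul, mul_inv_cancel₀ hε.ne', one_smul, add_comm]
    rw [e, Matrix.det_smul, Real.log_mul (pow_ne_zero _ hε.ne') hP.det_pos.ne', Real.log_pow]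
    simpa using hP
  obtain ⟨eA, -⟩ := key A hA
  obtain ⟨eB, pB⟩ := key B hB
  have hA' : (ε⁻¹ • A).PosSemidef := hA.smul (inv_nonneg.mpr hε.le)
  have h1 : 0 ≤ Real.log (1 + ε⁻¹ • A).det :=
    Real.log_nonneg (by linarith [one_add_trace_le_det_one_add hA', hA'.trace_nonneg])
  have h2 := log_det_le_trace_sub pB
  rw [Matrix.trace_add, Matrix.trace_smul, Matrix.trace_one, Fintype.card_fin, smul_eq_mul,
    inv_mul_eq_div] at h2
  rw [eA, eB]
  linarith

theorem sum_filter_val_lt_succ {T k : ℕ} (hk : k < T) (f : Fin T → ℝ) :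
    ∑ s ∈ Finset.univ.filter (fun s : Fin T => s.val < k + 1), f s
      = (∑ s ∈ Finset.univ.filter (fun s : Fin T => s.val < k), f s) + f ⟨k, hk⟩ := by
  have e : Finset.univ.filter (fun s : Fin T => s.val < k + 1)
      = insert ⟨k, hk⟩ (Finset.univ.filter (fun s : Fin T => s.val < k)) := by
    ext s
    simp only [Finset.mem_filter, Finset.mem_univ, true_and, Finset.mem_insert, Fin.ext_iff]
    omega
  rw [e, Finset.sum_insert (by simp), add_comm]

theorem stmt0 (N T : ℕ) (hN : 0 < N) (hT : 0 < T)
    (Γ : Matrix (Fin N) (Fin N) ℝ) (hΓ : Γ.PosDef)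
    (β τ g ε η ρ : ℝ) (hβ : 0 < β) (hτ : 0 < τ) (hg : 0 < g) (hε : 0 < ε) (hη : 0 < η)
    (hρ : ρ = ⨆ i, ⨆ j, |(Γ⁻¹ * Γ⁻¹) i j|)
    (K : Set (Matrix (Fin N) (Fin N) ℝ))
    (hK : K = {W | W.PosDef ∧ (∀ i j, |W i j| ≤ β) ∧ (Γ * W * Γ).trace ≤ τ})
    (L W : Fin T → Matrix (Fin N) (Fin N) ℝ)
    (hL : ∀ t, (L t).PosSemidef ∧ (∑ i, ∑ j, |L t i j|) ≤ g)
    (hW : ∀ t, W t ∈ K ∧ ∀ V ∈ K,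
      (- Real.log ((Γ * W t * Γ + ε • (1 : Matrix (Fin N) (Fin N) ℝ)).det)
        + η * ∑ s ∈ Finset.univ.filter (fun s => s < t), frob (L s) (W t))
      ≤ (- Real.log ((Γ * V * Γ + ε • (1 : Matrix (Fin N) (Fin N) ℝ)).det)
        + η * ∑ s ∈ Finset.univ.filter (fun s => s < t), frob (L s) V))
    (Wstar : Matrix (Fin N) (Fin N) ℝ) (hWstar : Wstar ∈ K) :
    ∑ t, frob (W t - Wstar) (L t)
      ≤ τ / (ε * η) + 1152 * Real.sqrt (Real.exp 1) * g ^ 2 * (β + ρ * ε) ^ 2 * η * T := by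
  have hρle : ∀ i j, |(Γ⁻¹ * Γ⁻¹) i j| ≤ ρ := by
    intro i j
    rw [hρ]
    exact (le_ciSup (f := fun j => |(Γ⁻¹ * Γ⁻¹) i j|) (Set.finite_range _).bddAbove j).trans
      (le_ciSup (f := fun i => ⨆ j, |(Γ⁻¹ * Γ⁻¹) i j|) (Set.finite_range _).bddAbove i)
  have hρ0 : 0 ≤ ρ := (abs_nonneg _).trans (hρle ⟨0, hN⟩ ⟨0, hN⟩)
  have hmem : ∀ V, V ∈ K ↔ V.PosDef ∧ (∀ i j, |V i j| ≤ β) ∧ (Γ * V * Γ).trace ≤ τ := by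
    intro V; rw [hK]; rfl
  have hconv : ∀ U ∈ K, ∀ V ∈ K, ∀ s ∈ Set.Ioo (0 : ℝ) 1, U + s • (V - U) ∈ K := by
    intro U hU V hV s hs
    rw [hmem] at hU hV ⊢
    have hs1 : 0 < 1 - s := by linarith [hs.2]
    have e : U + s • (V - U) = (1 - s) • U + s • V := by module
    rw [e]
    refine ⟨(hU.1.smul hs1).add (hV.1.smul hs.1), fun i j => ?_, ?_⟩
    · simp only [Matrix.add_apply, Matrix.smul_apply, smul_eq_mul]
      refine (abs_add_le _ _).trans ?_
      rw [abs_mul, abs_mul, abs_of_pos hs1, abs_of_pos hs.1]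
      nlinarith [hU.2.1 i j, hV.2.1 i j, hs.1]
    · simp only [Matrix.mul_add, Matrix.add_mul, Matrix.mul_smul, Matrix.smul_mul,
        Matrix.trace_add, Matrix.trace_smul, smul_eq_mul]
      nlinarith [hU.2.2, hV.2.2, hs.1]
  set c := g * (β + ρ * ε) with hcdef
  have main : ∀ k, k ≤ T → ∀ V ∈ K,
      -Real.log (Γ * W ⟨0, hT⟩ * Γ + ε • (1 : Matrix (Fin N) (Fin N) ℝ)).det
        + η * (∑ s ∈ Finset.univ.filter (fun s : Fin T => s.val < k), frob (L s) (W s))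
        - k * (η ^ 2 * (c ^ 2 / 2))
      ≤ -Real.log (Γ * V * Γ + ε • (1 : Matrix (Fin N) (Fin N) ℝ)).det
        + η * (∑ s ∈ Finset.univ.filter (fun s : Fin T => s.val < k), frob (L s) V) := by
    intro k
    induction k with
    | zero =>
      intro _ V hV
      have := (hW ⟨0, hT⟩).2 V hV
      simpa [Fin.lt_def] using this
    | succ k ih =>
      intro hk V hV
      have hk' : k < T := hk
      obtain ⟨hWK, hmin⟩ := hW ⟨k, hk'⟩
      have h1 := ih hk'.le _ hWK
      simp only [Fin.lt_def] at hmin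
      set S := Finset.univ.filter (fun s : Fin T => s.val < k) with hS
      have h2 := ftrl_logDet_stability (L := L ⟨k, hk'⟩) (c := c)
        (b := η * (∑ s ∈ S, frob (L s) V) - η * ∑ s ∈ S, frob (L s) (W ⟨k, hk'⟩))
        hΓ hε hη ((hmem _).1 hWK).1 ((hmem _).1 hV).1 (hL _).1
        (by
          have a1 := frob_le_mul_of_abs_le hβ.le (hL ⟨k, hk'⟩).2 ((hmem _).1 hWK).2.1
          have a2 := frob_le_mul_of_abs_le hρ0 (hL ⟨k, hk'⟩).2 hρle
          have a3 := mul_le_mul_of_nonneg_left a2 hε.le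
          rw [hcdef]; linarith)
        (by
          intro s hs
          have := hmin _ (hconv _ hWK V hV s hs)
          simp only [frob_add_smul_sub_right, Finset.sum_add_distrib, ← Finset.mul_sum,
            Finset.sum_sub_distrib] at this
          linarith)
      rw [sum_filter_val_lt_succ hk', sum_filter_val_lt_succ hk']
      push_cast
      linarith
  have hfin := main T le_rfl Wstar hWstar
  have hall : Finset.univ.filter (fun s : Fin T => s.val < T) = Finset.univ := by
    ext s; simp
  rw [hall] at hfin
  have hpsd : ∀ V ∈ K, (Γ * V * Γ).PosSemidef := by
    intro V hV
    have := ((hmem V).1 hV).1.posSemidef.mul_mul_conjTranspose_same Γ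
    rwa [hΓ.isHermitian.eq] at this
  have hW0 := (hW ⟨0, hT⟩).1
  have hrange := neg_log_det_sub_le_trace_div hε (hpsd _ hWstar) (hpsd _ hW0)
  have htr : (Γ * W ⟨0, hT⟩ * Γ).trace / ε ≤ τ / ε :=
    div_le_div_of_nonneg_right ((hmem _).1 hW0).2.2 hε.le
  have hreg : ∑ t, frob (W t - Wstar) (L t)
      = ∑ t, frob (L t) (W t) - ∑ t, frob (L t) Wstar := by
    rw [← Finset.sum_sub_distrib]
    exact Finset.sum_congr rfl fun t _ => by rw [frob_comm, frob_sub_right]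
  have hbound : η * ∑ t, frob (W t - Wstar) (L t) ≤ η * (τ / (ε * η) + c ^ 2 / 2 * η * T) := by
    have e : η * (τ / (ε * η) + c ^ 2 / 2 * η * T) = τ / ε + T * (η ^ 2 * (c ^ 2 / 2)) := by
      field_simp
    rw [hreg, e]
    linarith
  refine (le_of_mul_le_mul_left hbound hη).trans ?_
  have hsqrt : 1 ≤ Real.sqrt (Real.exp 1) :=
    Real.one_le_sqrt.mpr (Real.one_le_exp zero_le_one)
  have h0 : 0 ≤ c ^ 2 * η * T := by positivity
  have e : 1152 * Real.sqrt (Real.exp 1) * g ^ 2 * (β + ρ * ε) ^ 2 * η * T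
      = 1152 * Real.sqrt (Real.exp 1) * (c ^ 2 * η * T) := by rw [hcdef]; ring
  rw [e]
  nlinarith
end

section
/- Let N be a positive integer, let Σ, Θ, Γ ∈ ℝ^{N×N} be symmetric strictly positive definite matrices, and let δ ≥ 0. Suppose there exist indices i, j such that |Σ_{i,j} − Θ_{i,j}| ≥ δ (Σ_{i,i} + Θ_{i,i} + Σ_{j,j} + Θ_{j,j}). Then the total variation distance between the zero-mean Gaussian distributions on ℝ^N with covariance matrices Γ Σ Γ and Γ Θ Γ is at least δ / (12 e^{1/4}); that is, (1/2) ∫_{ℝ^N} |g_{ΓΣΓ}(x) − g_{ΓΘΓ}(x)| dx ≥ δ / (12 e^{1/4}). -/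
open Matrix MeasureTheory

/-- Density of the zero-mean Gaussian distribution on ℝ^N with covariance matrix `C`. -/
noncomputable def gaussDensity {N : ℕ} (C : Matrix (Fin N) (Fin N) ℝ) (x : Fin N → ℝ) : ℝ :=
  (2 * Real.pi) ^ (-(N : ℝ) / 2) * C.det ^ (-(1 : ℝ) / 2) *
    Real.exp (-(1 / 2) * (x ⬝ᵥ (C⁻¹ *ᵥ x)))

open scoped MatrixOrder in
theorem Matrix.PosDef.exists_eq_mul_transpose {n : Type*} [Fintype n] [DecidableEq n]
    {C : Matrix n n ℝ} (hC : C.PosDef) : ∃ A : Matrix n n ℝ, A.det ≠ 0 ∧ C = A * Aᵀ := by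
  obtain ⟨y, hy, rfl⟩ :=
    CStarAlgebra.isStrictlyPositive_iff_eq_star_mul_self.mp hC.isStrictlyPositive
  refine ⟨yᵀ, ?_, ?_⟩
  · rw [det_transpose]
    exact ((Matrix.isUnit_iff_isUnit_det y).mp hy).ne_zero
  · simp [star_eq_conjTranspose]

theorem integral_comp_mulVec {n : Type*} [Fintype n] [DecidableEq n] {M : Matrix n n ℝ}
    (hM : M.det ≠ 0) {f : (n → ℝ) → ℂ} (hf : Continuous f) :
    ∫ x, f (M *ᵥ x) = (|M.det|⁻¹ : ℝ) * ∫ x, f x := by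
  have hmap := Real.map_matrix_volume_pi_eq_smul_volume_pi hM
  have hint : ∫ y, f y ∂(Measure.map (toLin' M) volume) = ∫ x, f (toLin' M x) :=
    integral_map (LinearMap.continuous_on_pi _).aemeasurable hf.aestronglyMeasurable
  simp only [toLin'_apply] at hint
  rw [← hint, hmap, integral_smul_measure, ENNReal.toReal_ofReal (abs_nonneg _), abs_inv,
    Complex.real_smul]

/-- The characteristic function of a centred Gaussian density. -/
theorem integral_gaussDensity_mul_cexp {N : ℕ} {C : Matrix (Fin N) (Fin N) ℝ} (hC : C.PosDef)
    (u : Fin N → ℝ) :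
    ∫ x : Fin N → ℝ, (gaussDensity C x : ℂ) * Complex.exp ((u ⬝ᵥ x : ℝ) * Complex.I) =
      (Real.exp (-(1 / 2) * (u ⬝ᵥ (C *ᵥ u))) : ℂ) := by
  obtain ⟨A, hA, rfl⟩ := hC.exists_eq_mul_transpose
  have hAu : IsUnit A.det := isUnit_iff_ne_zero.mpr hA
  set w : Fin N → ℝ := Aᵀ *ᵥ u with hw
  have hw_inv (x : Fin N → ℝ) : u ⬝ᵥ x = w ⬝ᵥ (A⁻¹ *ᵥ x) := by
    rw [hw, mulVec_transpose, ← dotProduct_mulVec, mulVec_mulVec, mul_nonsing_inv _ hAu,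
      one_mulVec]
  have hquad_inv (x : Fin N → ℝ) :
      x ⬝ᵥ ((A * Aᵀ)⁻¹ *ᵥ x) = (A⁻¹ *ᵥ x) ⬝ᵥ (A⁻¹ *ᵥ x) := by
    rw [Matrix.mul_inv_rev, ← mulVec_mulVec, dotProduct_mulVec, ← transpose_nonsing_inv,
      vecMul_transpose]
  have hquad : u ⬝ᵥ ((A * Aᵀ) *ᵥ u) = w ⬝ᵥ w := by
    rw [← mulVec_mulVec, dotProduct_mulVec, ← mulVec_transpose]
  set f : (Fin N → ℝ) → ℂ := fun y => Complex.exp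
    (-(1 / 2 : ℂ) * ∑ i, (y i : ℂ) ^ 2 + ∑ i, (w i * Complex.I) * y i) with hf
  have hfc : Continuous f := by fun_prop
  have hcomp (x : Fin N → ℝ) : (gaussDensity (A * Aᵀ) x : ℂ) *
      Complex.exp ((u ⬝ᵥ x : ℝ) * Complex.I) =
      (((2 * Real.pi) ^ (-(N : ℝ) / 2) * (A * Aᵀ).det ^ (-(1 : ℝ) / 2) : ℝ) : ℂ) *
        f (A⁻¹ *ᵥ x) := by
    rw [gaussDensity, hquad_inv, hw_inv, Complex.ofReal_mul, mul_assoc, hf,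
      Complex.ofReal_exp, ← Complex.exp_add]
    congr 3
    · simp [dotProduct, pow_two]
    · simp only [dotProduct, Complex.ofReal_sum, Finset.sum_mul, Complex.ofReal_mul]
      exact Finset.sum_congr rfl fun i _ => by ring
  simp_rw [hcomp]
  rw [integral_const_mul, integral_comp_mulVec (by simp [det_nonsing_inv, hA]) hfc, hf,
    GaussianFourier.integral_cexp_neg_mul_sum_add (by norm_num), hquad]
  have hdet : |A⁻¹.det|⁻¹ = |A.det| := by
    rw [det_nonsing_inv, Ring.inverse_eq_inv', abs_inv, inv_inv]
  have hpi : ((Real.pi : ℂ) / (1 / 2)) ^ ((Fintype.card (Fin N) : ℂ) / 2) =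
      ((2 * Real.pi) ^ ((N : ℝ) / 2) : ℝ) := by
    rw [Complex.ofReal_cpow (by positivity)]
    push_cast
    rw [Fintype.card_fin]
    congr 1
    ring
  have hexp : Complex.exp ((∑ i, (w i * Complex.I) ^ 2) / (4 * (1 / 2))) =
      (Real.exp (-(1 / 2) * (w ⬝ᵥ w)) : ℝ) := by
    rw [Complex.ofReal_exp]
    congr 1
    simp only [mul_pow, Complex.I_sq, ← Finset.sum_mul, dotProduct]
    push_cast
    simp only [← pow_two]
    ring
  have hdet_pow : (A * Aᵀ).det ^ (-(1 : ℝ) / 2) * |A.det| = 1 := by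
    rw [det_mul, det_transpose, ← pow_two, ← sq_abs, neg_div, Real.rpow_neg (by positivity),
      ← Real.sqrt_eq_rpow, Real.sqrt_sq (abs_nonneg _), inv_mul_cancel₀ (abs_ne_zero.mpr hA)]
  have hpi_pow : (2 * Real.pi) ^ (-(N : ℝ) / 2) * (2 * Real.pi) ^ ((N : ℝ) / 2) = 1 := by
    rw [← Real.rpow_add (by positivity), neg_div, neg_add_cancel, Real.rpow_zero]
  rw [hpi, hexp, hdet, ← Complex.ofReal_mul, ← Complex.ofReal_mul, ← Complex.ofReal_mul]
  congr 1
  linear_combination (Real.exp (-(1 / 2) * (w ⬝ᵥ w))) *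
    ((2 * Real.pi) ^ (-(N : ℝ) / 2) * (2 * Real.pi) ^ ((N : ℝ) / 2) * hdet_pow + hpi_pow)

theorem integrable_gaussDensity_mul_cexp {N : ℕ} {C : Matrix (Fin N) (Fin N) ℝ} (hC : C.PosDef)
    (u : Fin N → ℝ) : Integrable fun x : Fin N → ℝ =>
      (gaussDensity C x : ℂ) * Complex.exp ((u ⬝ᵥ x : ℝ) * Complex.I) := by
  refine .of_integral_ne_zero ?_
  rw [integral_gaussDensity_mul_cexp hC u]
  exact Complex.ofReal_ne_zero.mpr (Real.exp_ne_zero _)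

theorem abs_exp_quadForm_sub_le_integral {N : ℕ} {C D : Matrix (Fin N) (Fin N) ℝ}
    (hC : C.PosDef) (hD : D.PosDef) (u : Fin N → ℝ) :
    |Real.exp (-(1 / 2) * (u ⬝ᵥ (C *ᵥ u))) - Real.exp (-(1 / 2) * (u ⬝ᵥ (D *ᵥ u)))| ≤
      ∫ x : Fin N → ℝ, |gaussDensity C x - gaussDensity D x| := by
  rw [← Real.norm_eq_abs, ← Complex.norm_real, Complex.ofReal_sub,
    ← integral_gaussDensity_mul_cexp hC, ← integral_gaussDensity_mul_cexp hD,
    ← integral_sub (integrable_gaussDensity_mul_cexp hC u)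
      (integrable_gaussDensity_mul_cexp hD u)]
  refine (norm_integral_le_integral_norm _).trans_eq (integral_congr_ae (.of_forall fun x => ?_))
  simp only [← sub_mul, norm_mul, Complex.norm_exp_ofReal_mul_I, mul_one, ← Complex.ofReal_sub,
    Complex.norm_real, Real.norm_eq_abs]

theorem abs_sub_mul_exp_neg_le {a b c : ℝ} (ha : a ≤ c) (hb : b ≤ c) :
    |a - b| * Real.exp (-c) ≤ |Real.exp (-a) - Real.exp (-b)| := by
  wlog hab : a ≤ b generalizing a b
  · rw [abs_sub_comm a, abs_sub_comm (Real.exp _)]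
    exact this hb ha (le_of_not_ge hab)
  rw [abs_of_nonpos (by linarith), abs_of_nonneg (by simpa using hab)]
  have h1 : (b - a) * Real.exp (-b) ≤ Real.exp (-a) - Real.exp (-b) := by
    have h2 : Real.exp (-a) = Real.exp (b - a) * Real.exp (-b) := by
      rw [← Real.exp_add]; ring_nf
    nlinarith [Real.add_one_le_exp (b - a), Real.exp_pos (-b)]
  have h3 : Real.exp (-c) ≤ Real.exp (-b) := by simpa using hb
  nlinarith

theorem quadForm_mul_inv_mulVec {n : Type*} [Fintype n] [DecidableEq n] {G C : Matrix n n ℝ}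
    (hG : G.PosDef) (v : n → ℝ) :
    (G⁻¹ *ᵥ v) ⬝ᵥ ((G * C * G) *ᵥ (G⁻¹ *ᵥ v)) = v ⬝ᵥ (C *ᵥ v) := by
  have hu : IsUnit G.det := (Matrix.isUnit_iff_isUnit_det G).mp hG.isUnit
  have hGt : G⁻¹ᵀ = G⁻¹ := by
    simpa [IsHermitian] using hG.inv.isHermitian
  rw [mulVec_mulVec, mul_nonsing_inv_cancel_right _ _ hu, ← mulVec_mulVec, ← hGt,
    mulVec_transpose, ← dotProduct_mulVec, mulVec_mulVec, nonsing_inv_mul _ hu, one_mulVec]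

theorem posDef_mul_mul_self {n : Type*} [Fintype n] [DecidableEq n] {G C : Matrix n n ℝ}
    (hG : G.PosDef) (hC : C.PosDef) : (G * C * G).PosDef := by
  have h := hC.conjTranspose_mul_mul_same (B := G) (mulVec_injective_of_isUnit hG.isUnit)
  rwa [hG.isHermitian.eq] at h

theorem quadForm_single_add_smul_single {n : Type*} [Fintype n] [DecidableEq n]
    {C : Matrix n n ℝ} (hC : C.IsHermitian) (i j : n) (s t : ℝ) :
    (Pi.single i s + Pi.single j t) ⬝ᵥ (C *ᵥ (Pi.single i s + Pi.single j t)) =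
      s ^ 2 * C i i + 2 * s * t * C i j + t ^ 2 * C j j := by
  have h : C j i = C i j := by simpa using hC.apply i j
  simp [mulVec_add, add_dotProduct, dotProduct_add, mulVec_single, h]
  ring

theorem stmt2 (N : ℕ) (hN : 0 < N)
    (Sig Th Γ : Matrix (Fin N) (Fin N) ℝ)
    (hSig : Sig.PosDef) (hTh : Th.PosDef) (hΓ : Γ.PosDef)
    (δ : ℝ) (hδ : 0 ≤ δ)
    (hij : ∃ i j, δ * (Sig i i + Th i i + Sig j j + Th j j) ≤ |Sig i j - Th i j|) :
    δ / (12 * Real.exp (1 / 4)) ≤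
      (1 / 2) * ∫ x : Fin N → ℝ,
        |gaussDensity (Γ * Sig * Γ) x - gaussDensity (Γ * Th * Γ) x| := by
  obtain ⟨i, j, hij⟩ := hij
  set S := Sig i i + Th i i + Sig j j + Th j j with hS
  have hSpos : 0 < S := by
    linarith [hSig.diag_pos (i := i), hSig.diag_pos (i := j), hTh.diag_pos (i := i),
      hTh.diag_pos (i := j)]
  have key (v : Fin N → ℝ) := abs_exp_quadForm_sub_le_integral (posDef_mul_mul_self hΓ hSig)
    (posDef_mul_mul_self hΓ hTh) (Γ⁻¹ *ᵥ v)
  simp_rw [quadForm_mul_inv_mulVec hΓ] at key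
  set I := ∫ x : Fin N → ℝ, |gaussDensity (Γ * Sig * Γ) x - gaussDensity (Γ * Th * Γ) x|
  have hnonneg {C : Matrix (Fin N) (Fin N) ℝ} (hC : C.PosDef) (s t : ℝ) :
      0 ≤ s ^ 2 * C i i + 2 * s * t * C i j + t ^ 2 * C j j := by
    rw [← quadForm_single_add_smul_single hC.isHermitian]
    exact hC.posSemidef.dotProduct_mulVec_nonneg (Pi.single i s + Pi.single j t)
  set r := √S⁻¹ with hr
  have hr2 : r ^ 2 * S = 1 := by
    rw [hr, Real.sq_sqrt (by positivity), inv_mul_cancel₀ hSpos.ne']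
  obtain ⟨t, ht, hdiff⟩ : ∃ t : ℝ, t ^ 2 = r ^ 2 ∧
      2 * δ ≤ |(r ^ 2 * Sig i i + 2 * r * t * Sig i j + t ^ 2 * Sig j j) -
        (r ^ 2 * Th i i + 2 * r * t * Th i j + t ^ 2 * Th j j)| := by
    have h4 : 4 * δ ≤ 4 * r ^ 2 * |Sig i j - Th i j| := by
      nlinarith [mul_le_mul_of_nonneg_left hij (sq_nonneg r)]
    by_contra! hcon
    have hp := abs_lt.mp (hcon r rfl)
    have hm := abs_lt.mp (hcon (-r) (by ring))
    rcases abs_cases (Sig i j - Th i j) with ⟨h, -⟩ | ⟨h, -⟩ <;> rw [h] at h4 <;> nlinarith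
  have hk := key (Pi.single i r + Pi.single j t)
  rw [quadForm_single_add_smul_single hSig.isHermitian,
    quadForm_single_add_smul_single hTh.isHermitian, neg_mul, neg_mul] at hk
  set a := r ^ 2 * Sig i i + 2 * r * t * Sig i j + t ^ 2 * Sig j j with ha
  set b := r ^ 2 * Th i i + 2 * r * t * Th i j + t ^ 2 * Th j j with hb
  have hab : a + b ≤ 2 := by
    have h1 := hnonneg hSig r (-t)
    have h2 := hnonneg hTh r (-t)
    have h3 : r ^ 2 * S = r ^ 2 * Sig i i + r ^ 2 * Th i i + t ^ 2 * Sig j j + t ^ 2 * Th j j := by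
      rw [hS, ht]; ring
    linarith
  have ha0 : 0 ≤ a := hnonneg hSig r t
  have hb0 : 0 ≤ b := hnonneg hTh r t
  have hle := (abs_sub_mul_exp_neg_le (a := 1 / 2 * a) (b := 1 / 2 * b) (c := 1)
    (by linarith) (by linarith)).trans hk
  have hδI : δ * Real.exp (-1) ≤ I := by
    refine (mul_le_mul_of_nonneg_right ?_ (Real.exp_pos _).le).trans hle
    rw [← mul_sub, abs_mul, abs_of_pos (by norm_num : (0 : ℝ) < 1 / 2)]
    linarith
  have hconst : 1 / (12 * Real.exp (1 / 4)) ≤ 1 / 2 * Real.exp (-1) := by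
    rw [Real.exp_neg, div_le_iff₀ (by positivity)]
    have he : Real.exp 1 * (Real.exp 1)⁻¹ = 1 := mul_inv_cancel₀ (Real.exp_ne_zero _)
    have h1 : 1 ≤ Real.exp (1 / 4) := Real.one_le_exp (by norm_num)
    have h3 : 1 / 3 ≤ (Real.exp 1)⁻¹ := by
      rw [one_div]
      exact inv_anti₀ (Real.exp_pos _) (by linarith [Real.exp_one_lt_d9])
    nlinarith
  calc δ / (12 * Real.exp (1 / 4)) = δ * (1 / (12 * Real.exp (1 / 4))) := by ring
    _ ≤ δ * (1 / 2 * Real.exp (-1)) := mul_le_mul_of_nonneg_left hconst hδ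
    _ ≤ 1 / 2 * I := by linarith
end

section
/- Let N be a positive integer, let Σ, Θ, Γ ∈ ℝ^{N×N} be symmetric strictly positive definite matrices, and let δ ≥ 0. Suppose there exist indices i, j such that |Σ_{i,j} − Θ_{i,j}| ≥ δ (Σ_{i,i} + Θ_{i,i} + Σ_{j,j} + Θ_{j,j}). Then there exists u ∈ ℝ^N such that |exp(−(1/2) uᵀ Γ Σ Γ u) − exp(−(1/2) uᵀ Γ Θ Γ u)| ≥ δ / (6 e^{1/4}). -/
open Matrix

theorem Real.abs_sub_mul_exp_neg_le {x y M : ℝ} (hx : x ≤ M) (hy : y ≤ M) :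
    |x - y| * Real.exp (-M) ≤ |Real.exp (-x) - Real.exp (-y)| := by
  wlog h : x ≤ y generalizing x y
  · rw [abs_sub_comm x, abs_sub_comm (Real.exp (-x))]
    exact this hy hx (le_of_not_ge h)
  have h₁ : Real.exp (-x) = Real.exp (-y) * Real.exp (y - x) := by
    rw [← Real.exp_add]; congr 1; ring
  have h₂ := Real.add_one_le_exp (y - x)
  have h₃ : Real.exp (-M) ≤ Real.exp (-y) := Real.exp_le_exp.2 (by linarith)
  refine le_trans ?_ (le_abs_self _)
  rw [abs_sub_comm, abs_of_nonneg (by linarith : 0 ≤ y - x)]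
  nlinarith [Real.exp_pos (-y)]

namespace Matrix

variable {n : Type*} [Fintype n] [DecidableEq n]

theorem IsSymm.dotProduct_conj_mulVec_inv {R : Type*} [CommRing R] {P : Matrix n n R}
    (hP : P.IsSymm) (hdet : IsUnit P.det) (A : Matrix n n R) (v : n → R) :
    (P⁻¹ *ᵥ v) ⬝ᵥ ((P * A * P) *ᵥ (P⁻¹ *ᵥ v)) = v ⬝ᵥ (A *ᵥ v) := by
  have h : P *ᵥ (P⁻¹ *ᵥ v) = v := by
    rw [mulVec_mulVec, mul_nonsing_inv _ hdet, one_mulVec]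
  rw [← mulVec_mulVec, h, ← mulVec_mulVec, dotProduct_mulVec, ← mulVec_transpose, hP.eq, h]

theorem IsSymm.dotProduct_mulVec_single_add_single {R : Type*} [CommRing R] {A : Matrix n n R}
    (hA : A.IsSymm) (i j : n) (s r : R) :
    (Pi.single i s + Pi.single j r) ⬝ᵥ (A *ᵥ (Pi.single i s + Pi.single j r)) =
      s ^ 2 * A i i + 2 * (s * r) * A i j + r ^ 2 * A j j := by
  have h := hA.apply i j
  simp [mulVec_add, add_dotProduct, dotProduct_add, mulVec_single, h]
  ring

end Matrix

theorem stmt3 (N : ℕ) (hN : 0 < N)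
    (Sig Th Γ : Matrix (Fin N) (Fin N) ℝ)
    (hSig : Sig.PosDef) (hTh : Th.PosDef) (hΓ : Γ.PosDef)
    (δ : ℝ) (hδ : 0 ≤ δ)
    (hij : ∃ i j, δ * (Sig i i + Th i i + Sig j j + Th j j) ≤ |Sig i j - Th i j|) :
    ∃ u : Fin N → ℝ,
      δ / (6 * Real.exp (1 / 4)) ≤
        |Real.exp (-(1 / 2) * (u ⬝ᵥ ((Γ * Sig * Γ) *ᵥ u)))
          - Real.exp (-(1 / 2) * (u ⬝ᵥ ((Γ * Th * Γ) *ᵥ u)))| := by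
  obtain ⟨i, j, hij⟩ := hij
  have symm {A : Matrix (Fin N) (Fin N) ℝ} (hA : A.PosDef) : A.IsSymm := by
    simpa [Matrix.IsHermitian, Matrix.IsSymm, conjTranspose_eq_transpose_of_trivial]
      using hA.isHermitian
  have bound {A : Matrix (Fin N) (Fin N) ℝ} (hA : A.PosDef) (r : ℝ) :
      0 ≤ 1 ^ 2 * A i i + 2 * (1 * r) * A i j + r ^ 2 * A j j := by
    rw [← (symm hA).dotProduct_mulVec_single_add_single]
    simpa only [star_trivial] using
      hA.posSemidef.dotProduct_mulVec_nonneg (Pi.single i 1 + Pi.single j r)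
  set T := Sig i i + Th i i + Sig j j + Th j j with hT
  have hTpos : 0 < T := by
    linarith [hSig.diag_pos (i := i), hSig.diag_pos (i := j), hTh.diag_pos (i := i),
      hTh.diag_pos (i := j)]
  obtain ⟨ε, hε, hD⟩ : ∃ ε : ℝ, (ε = 1 ∨ ε = -1) ∧
      2 * |Sig i j - Th i j| ≤ |(Sig i i + 2 * ε * Sig i j + Sig j j) -
        (Th i i + 2 * ε * Th i j + Th j j)| := by
    by_contra! h
    have h₁ := abs_lt.1 (h 1 (.inl rfl))
    have h₂ := abs_lt.1 (h (-1) (.inr rfl))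
    rcases abs_cases (Sig i j - Th i j) with h₃ | h₃ <;> linarith
  have hε2 : ε ^ 2 = 1 := by rcases hε with rfl | rfl <;> norm_num
  set a := Sig i i + 2 * ε * Sig i j + Sig j j with ha
  set b := Th i i + 2 * ε * Th i j + Th j j with hb
  have hS₁ := bound hSig 1
  have hS₂ := bound hSig (-1)
  have hT₁ := bound hTh 1
  have hT₂ := bound hTh (-1)
  have ha2 : a ≤ 2 * T := by rcases hε with rfl | rfl <;> linarith
  have hb2 : b ≤ 2 * T := by rcases hε with rfl | rfl <;> linarith
  set s := √(1 / (4 * T))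
  have hs : s ^ 2 = 1 / (4 * T) := Real.sq_sqrt (by positivity)
  have form {A : Matrix (Fin N) (Fin N) ℝ} (hA : A.PosDef) :
      -(1 / 2) * ((Γ⁻¹ *ᵥ (Pi.single i s + Pi.single j (s * ε))) ⬝ᵥ
        ((Γ * A * Γ) *ᵥ (Γ⁻¹ *ᵥ (Pi.single i s + Pi.single j (s * ε))))) =
      -((A i i + 2 * ε * A i j + A j j) / (8 * T)) := by
    rw [(symm hΓ).dotProduct_conj_mulVec_inv hΓ.det_pos.ne'.isUnit,
      (symm hA).dotProduct_mulVec_single_add_single]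
    have : s ^ 2 * A i i + 2 * (s * (s * ε)) * A i j + (s * ε) ^ 2 * A j j =
        s ^ 2 * (A i i + 2 * ε * A i j + A j j) := by
      rw [mul_pow, hε2]; ring
    rw [this, hs]
    field_simp
    ring
  refine ⟨Γ⁻¹ *ᵥ (Pi.single i s + Pi.single j (s * ε)), ?_⟩
  rw [form hSig, form hTh, ← ha, ← hb]
  have scale {x : ℝ} (hx : x ≤ 2 * T) : x / (8 * T) ≤ 1 / 4 := by
    rw [div_le_iff₀ (by positivity)]; linarith
  refine le_trans ?_ (Real.abs_sub_mul_exp_neg_le (scale ha2) (scale hb2))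
  have hδ4 : δ / 4 ≤ |a / (8 * T) - b / (8 * T)| := by
    rw [← sub_div, abs_div, abs_of_pos (by positivity : 0 < 8 * T),
      le_div_iff₀ (by positivity)]
    linarith
  rw [Real.exp_neg, ← div_div, div_eq_mul_inv]
  gcongr
  linarith
end

section
/- Let N be a positive integer, let X, Y ∈ ℝ^{N×N} be symmetric strictly positive definite matrices, let Γ ∈ ℝ^{N×N} be symmetric strictly positive definite, let δ ≥ 0 and α ∈ [0,1]. Suppose there exist indices i, j such that |X_{i,j} − Y_{i,j}| ≥ δ (X_{i,i} + Y_{i,i} + X_{j,j} + Y_{j,j}). Then −ln det(α Γ X Γ + (1−α) Γ Y Γ) ≤ −α ln det(Γ X Γ) − (1−α) ln det(Γ Y Γ) − (α(1−α)/2) · δ² / (72 e^{1/2}). -/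
open Matrix

theorem Real.log_le_log_add_div_sub_sq {x m M : ℝ} (hx : 0 < x) (hm : 0 < m) (hxM : x ≤ M)
    (hmM : m ≤ M) :
    Real.log x ≤ Real.log m + (x - m) / m - (x - m) ^ 2 / (4 * M ^ 2) := by
  obtain ⟨a, ha, rfl⟩ : ∃ a, 0 < a ∧ a ^ 2 = x := ⟨√x, Real.sqrt_pos.2 hx, Real.sq_sqrt hx.le⟩
  obtain ⟨b, hb, rfl⟩ : ∃ b, 0 < b ∧ b ^ 2 = m := ⟨√m, Real.sqrt_pos.2 hm, Real.sq_sqrt hm.le⟩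
  have hM : 0 < M := hx.trans_le hxM
  have hlog := Real.log_le_sub_one_of_pos (div_pos ha hb)
  rw [Real.log_div ha.ne' hb.ne'] at hlog
  have hsq : (a ^ 2 - b ^ 2) ^ 2 / (4 * M ^ 2) ≤ (a - b) ^ 2 / b ^ 2 := by
    rw [div_le_div_iff₀ (by positivity) (by positivity)]
    have hab : (a + b) ^ 2 ≤ 4 * M := by nlinarith [sq_nonneg (a - b)]
    have hprod : (a + b) ^ 2 * b ^ 2 ≤ 4 * M * M := by gcongr
    calc (a ^ 2 - b ^ 2) ^ 2 * b ^ 2 = (a - b) ^ 2 * ((a + b) ^ 2 * b ^ 2) := by ring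
      _ ≤ (a - b) ^ 2 * (4 * M * M) := by gcongr
      _ = (a - b) ^ 2 * (4 * M ^ 2) := by ring
  have hid : (a ^ 2 - b ^ 2) / b ^ 2 - (a - b) ^ 2 / b ^ 2 = 2 * (a / b - 1) := by
    field_simp
    ring
  rw [Real.log_pow, Real.log_pow]
  push_cast
  linarith

theorem Real.mul_log_add_sq_le_log {α x y M : ℝ} (hα0 : 0 ≤ α) (hα1 : α ≤ 1) (hx : 0 < x)
    (hy : 0 < y) (hxM : x ≤ M) (hyM : y ≤ M) :
    α * Real.log x + (1 - α) * Real.log y + α * (1 - α) * ((x - y) ^ 2 / (4 * M ^ 2))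
      ≤ Real.log (α * x + (1 - α) * y) := by
  set m := α * x + (1 - α) * y with hmdef
  have hβ : 0 ≤ 1 - α := sub_nonneg.2 hα1
  have hm : 0 < m := by
    rcases hα0.eq_or_lt with h | h
    · simp [hmdef, ← h, hy]
    · have := mul_nonneg hβ hy.le
      have := mul_pos h hx
      linarith
  have hmM : m ≤ M := by nlinarith
  have h₁ := mul_le_mul_of_nonneg_left (Real.log_le_log_add_div_sub_sq hx hm hxM hmM) hα0
  have h₂ := mul_le_mul_of_nonneg_left (Real.log_le_log_add_div_sub_sq hy hm hyM hmM) hβ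
  have hlin : α * ((x - m) / m) + (1 - α) * ((y - m) / m) = 0 := by
    rw [← mul_div_assoc, ← mul_div_assoc, ← add_div, hmdef]
    ring_nf
  have hquad : α * ((x - m) ^ 2 / (4 * M ^ 2)) + (1 - α) * ((y - m) ^ 2 / (4 * M ^ 2))
      = α * (1 - α) * ((x - y) ^ 2 / (4 * M ^ 2)) := by
    rw [hmdef]
    ring
  linarith

namespace Matrix

open scoped MatrixOrder

variable {n : Type*} [Fintype n] [DecidableEq n]

theorem PosDef.exists_orthogonal_diagonalization {C : Matrix n n ℝ} (hC : C.PosDef) :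
    ∃ (U : Matrix n n ℝ) (μ : n → ℝ), U * Uᵀ = 1 ∧ (∀ k, 0 < μ k) ∧ C = U * diagonal μ * Uᵀ := by
  refine ⟨hC.1.eigenvectorUnitary, hC.1.eigenvalues, ?_, hC.eigenvalues_pos, ?_⟩
  · have h := Unitary.coe_mul_star_self hC.1.eigenvectorUnitary
    rwa [Unitary.coe_star, star_eq_conjTranspose, conjTranspose_eq_transpose_of_trivial] at h
  · have h := hC.1.spectral_theorem
    rw [Unitary.conjStarAlgAut_apply, star_eq_conjTranspose,
      conjTranspose_eq_transpose_of_trivial] at h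
    exact h

theorem PosDef.exists_simultaneous_diagonalization {X Y : Matrix n n ℝ} (hX : X.PosDef)
    (hY : Y.PosDef) :
    ∃ (S : Matrix n n ℝ) (μ : n → ℝ), IsUnit S ∧ (∀ k, 0 < μ k) ∧
      X = S * Sᵀ ∧ Y = S * diagonal μ * Sᵀ := by
  obtain ⟨B, hB, rfl⟩ : ∃ B : Matrix n n ℝ, IsUnit B ∧ X = Bᵀ * B := by
    obtain ⟨B, rfl⟩ := CStarAlgebra.nonneg_iff_eq_star_mul_self.1 hX.posSemidef.nonneg
    refine ⟨B, ?_, by rw [star_eq_conjTranspose, conjTranspose_eq_transpose_of_trivial]⟩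
    exact isUnit_of_mul_isUnit_right hX.isUnit
  have hC : ((B⁻¹)ᵀ * Y * B⁻¹).PosDef := by
    have h := hY.conjTranspose_mul_mul_same (B := B⁻¹)
      (mulVec_injective_iff_isUnit.2 (isUnit_nonsing_inv_iff.2 hB))
    rwa [conjTranspose_eq_transpose_of_trivial] at h
  obtain ⟨U, μ, hUU, hμ, hspec⟩ := hC.exists_orthogonal_diagonalization
  have hdet : IsUnit B.det := (isUnit_iff_isUnit_det B).1 hB
  have hBinv : B⁻¹ * B = 1 := nonsing_inv_mul B hdet
  have hBinvT : Bᵀ * (B⁻¹)ᵀ = 1 := by rw [← transpose_mul, hBinv, transpose_one]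
  refine ⟨Bᵀ * U, μ, ?_, hμ, ?_, ?_⟩
  · exact (B.isUnit_transpose.2 hB).mul (IsUnit.of_mul_eq_one _ hUU)
  · rw [transpose_mul, transpose_transpose, Matrix.mul_assoc, ← Matrix.mul_assoc U, hUU,
      Matrix.one_mul]
  · calc Y = (Bᵀ * (B⁻¹)ᵀ) * Y * (B⁻¹ * B) := by rw [hBinv, hBinvT, Matrix.one_mul, Matrix.mul_one]
      _ = Bᵀ * ((B⁻¹)ᵀ * Y * B⁻¹) * B := by simp only [Matrix.mul_assoc]
      _ = Bᵀ * U * diagonal μ * (Bᵀ * U)ᵀ := by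
        rw [hspec, transpose_mul, transpose_transpose]
        simp only [Matrix.mul_assoc]

theorem mul_diagonal_mul_transpose_apply (S : Matrix n n ℝ) (d : n → ℝ) (i j : n) :
    (S * diagonal d * Sᵀ) i j = ∑ k, S i k * d k * S j k := by
  rw [mul_apply]
  simp only [mul_diagonal, transpose_apply]

theorem exists_abs_one_sub_ge {S : Matrix n n ℝ} {μ : n → ℝ} (hμ : ∀ k, 0 < μ k)
    {X Y : Matrix n n ℝ} (hX : X = S * Sᵀ) (hY : Y = S * diagonal μ * Sᵀ) {i j : n}
    {δ : ℝ} (hpos : 0 < X i i + Y i i + X j j + Y j j)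
    (hij : δ * (X i i + Y i i + X j j + Y j j) ≤ |X i j - Y i j|) :
    ∃ k, 2 * δ * (1 + μ k) ≤ |1 - μ k| := by
  by_contra! h
  have hX' : ∀ i j, X i j = ∑ k, S i k * S j k := fun i j => by simp [hX, mul_apply]
  have hY' : ∀ i j, Y i j = ∑ k, S i k * μ k * S j k := fun i j => by
    rw [hY, mul_diagonal_mul_transpose_apply]
  have hsum : X i i + Y i i + X j j + Y j j
      = ∑ k, (1 + μ k) * (S i k ^ 2 + S j k ^ 2) := by
    simp only [hX', hY', ← Finset.sum_add_distrib]
    exact Finset.sum_congr rfl fun k _ => by ring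
  obtain ⟨k₀, -, hk₀⟩ : ∃ k ∈ Finset.univ, 0 < (1 + μ k) * (S i k ^ 2 + S j k ^ 2) := by
    by_contra! hle
    exact absurd (Finset.sum_nonpos hle) (by rw [← hsum]; exact hpos.not_ge)
  have hsq : ∀ k, |S i k * S j k| ≤ (S i k ^ 2 + S j k ^ 2) / 2 := fun k => by
    rw [abs_mul]
    nlinarith [sq_nonneg (|S i k| - |S j k|), sq_abs (S i k), sq_abs (S j k)]
  have hlt : |X i j - Y i j| < δ * (X i i + Y i i + X j j + Y j j) := by
    calc |X i j - Y i j| = |∑ k, (1 - μ k) * (S i k * S j k)| := by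
          rw [hX', hY', ← Finset.sum_sub_distrib]
          exact congrArg _ (Finset.sum_congr rfl fun k _ => by ring)
      _ ≤ ∑ k, |1 - μ k| * |S i k * S j k| := by
          simpa only [abs_mul] using Finset.abs_sum_le_sum_abs
            (fun k => (1 - μ k) * (S i k * S j k)) Finset.univ
      _ ≤ ∑ k, |1 - μ k| * ((S i k ^ 2 + S j k ^ 2) / 2) :=
          Finset.sum_le_sum fun k _ => mul_le_mul_of_nonneg_left (hsq k) (abs_nonneg _)
      _ < ∑ k, 2 * δ * (1 + μ k) * ((S i k ^ 2 + S j k ^ 2) / 2) := by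
          refine Finset.sum_lt_sum (fun k _ => ?_) ⟨k₀, Finset.mem_univ _, ?_⟩
          · exact mul_le_mul_of_nonneg_right (h k).le (by positivity)
          · exact mul_lt_mul_of_pos_right (h k₀)
              (half_pos (pos_of_mul_pos_right hk₀ (by linarith [hμ k₀])))
      _ = δ * (X i i + Y i i + X j j + Y j j) := by
          rw [hsum, Finset.mul_sum]
          exact Finset.sum_congr rfl fun k _ => by ring
  exact hlt.not_ge hij

/-- Strong concavity of `log ∘ det` on positive definite matrices. -/
theorem PosDef.mul_log_det_add_sq_le_log_det {X Y : Matrix n n ℝ} (hX : X.PosDef) (hY : Y.PosDef)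
    {δ α : ℝ} (hδ : 0 ≤ δ) (hα0 : 0 ≤ α) (hα1 : α ≤ 1) {i j : n}
    (hij : δ * (X i i + Y i i + X j j + Y j j) ≤ |X i j - Y i j|) :
    α * Real.log X.det + (1 - α) * Real.log Y.det + α * (1 - α) * δ ^ 2
      ≤ Real.log (α • X + (1 - α) • Y).det := by
  have hpos : 0 < X i i + Y i i + X j j + Y j j := by
    linarith [hX.diag_pos (i := i), hX.diag_pos (i := j), hY.diag_pos (i := i),
      hY.diag_pos (i := j)]
  obtain ⟨S, μ, hS, hμ, hXS, hYS⟩ := hX.exists_simultaneous_diagonalization hY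
  obtain ⟨k₀, hk₀⟩ := exists_abs_one_sub_ge hμ hXS hYS hpos hij
  have hβ : 0 ≤ 1 - α := sub_nonneg.2 hα1
  have hconv : α • X + (1 - α) • Y = S * diagonal (fun k => α + (1 - α) * μ k) * Sᵀ := by
    have hd : diagonal (fun k => α + (1 - α) * μ k)
        = α • (1 : Matrix n n ℝ) + (1 - α) • diagonal μ := by
      rw [← diagonal_one, ← diagonal_smul, ← diagonal_smul, diagonal_add]
      simp
    rw [hd, hXS, hYS]
    simp [Matrix.mul_add, Matrix.add_mul]
  have hdetS : S.det ≠ 0 := ((isUnit_iff_isUnit_det S).1 hS).ne_zero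
  have hgap : ∀ k, α * (1 - α) * ((1 - μ k) ^ 2 / (4 * (1 + μ k) ^ 2))
      ≤ Real.log (α + (1 - α) * μ k) - (1 - α) * Real.log (μ k) := fun k => by
    have := Real.mul_log_add_sq_le_log hα0 hα1 one_pos (hμ k) (M := 1 + μ k)
      (by linarith [hμ k]) (by linarith)
    rw [Real.log_one, mul_one] at this
    linarith
  have hmix : ∀ k, 0 < α + (1 - α) * μ k := fun k => by
    rcases hα0.eq_or_lt with h | h
    · simp [← h, hμ k]
    · exact add_pos_of_pos_of_nonneg h (mul_nonneg hβ (hμ k).le)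
  have hlogdet : ∀ d : n → ℝ, (∀ k, 0 < d k) → Real.log (S * diagonal d * Sᵀ).det
      = Real.log (S.det ^ 2) + ∑ k, Real.log (d k) := fun d hd => by
    rw [det_mul, det_mul, det_transpose, det_diagonal,
      show S.det * (∏ k, d k) * S.det = S.det ^ 2 * ∏ k, d k by ring,
      Real.log_mul (pow_ne_zero _ hdetS) (Finset.prod_ne_zero_iff.2 fun k _ => (hd k).ne'),
      Real.log_prod fun k _ => (hd k).ne']
  have hsingle : α * (1 - α) * δ ^ 2
      ≤ ∑ k, (Real.log (α + (1 - α) * μ k) - (1 - α) * Real.log (μ k)) := by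
    have hpos₀ : 0 < 1 + μ k₀ := by linarith [hμ k₀]
    calc α * (1 - α) * δ ^ 2
        ≤ α * (1 - α) * ((1 - μ k₀) ^ 2 / (4 * (1 + μ k₀) ^ 2)) := by
          refine mul_le_mul_of_nonneg_left ?_ (mul_nonneg hα0 hβ)
          rw [le_div_iff₀ (by positivity), ← sq_abs (1 - μ k₀)]
          calc δ ^ 2 * (4 * (1 + μ k₀) ^ 2) = (2 * δ * (1 + μ k₀)) ^ 2 := by ring
            _ ≤ |1 - μ k₀| ^ 2 := by gcongr
      _ ≤ _ := hgap k₀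
      _ ≤ _ := Finset.single_le_sum
          (f := fun k => Real.log (α + (1 - α) * μ k) - (1 - α) * Real.log (μ k))
          (fun k _ => le_trans (mul_nonneg (mul_nonneg hα0 hβ) (by positivity)) (hgap k))
          (Finset.mem_univ k₀)
  have hdetX : X.det = S.det ^ 2 := by rw [hXS, det_mul, det_transpose, sq]
  rw [hconv, hdetX, hYS, hlogdet _ hmix, hlogdet _ hμ]
  rw [Finset.sum_sub_distrib, ← Finset.mul_sum] at hsingle
  linarith

end Matrix

theorem stmt4 (N : ℕ) (hN : 0 < N)
    (X Y Γ : Matrix (Fin N) (Fin N) ℝ) (hX : X.PosDef) (hY : Y.PosDef) (hΓ : Γ.PosDef)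
    (δ α : ℝ) (hδ : 0 ≤ δ) (hα : α ∈ Set.Icc (0 : ℝ) 1)
    (hij : ∃ i j, δ * (X i i + Y i i + X j j + Y j j) ≤ |X i j - Y i j|) :
    -Real.log ((α • (Γ * X * Γ) + (1 - α) • (Γ * Y * Γ)).det)
      ≤ -(α * Real.log ((Γ * X * Γ).det)) - (1 - α) * Real.log ((Γ * Y * Γ).det)
        - α * (1 - α) / 2 * (δ ^ 2 / (72 * Real.exp (1 / 2))) := by
  obtain ⟨i, j, hij⟩ := hij
  obtain ⟨hα0, hα1⟩ := hα
  have hβ : 0 ≤ 1 - α := sub_nonneg.2 hα1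
  have hmain := hX.mul_log_det_add_sq_le_log_det hY hδ hα0 hα1 hij
  have hmix : (α • X + (1 - α) • Y).det ≠ 0 := by
    rcases hα0.eq_or_lt with h | h
    · simpa [← h] using hY.det_pos.ne'
    · exact ((hX.smul h).add_posSemidef (hY.posSemidef.smul hβ)).det_pos.ne'
  have hlogdet : ∀ A : Matrix (Fin N) (Fin N) ℝ, A.det ≠ 0 →
      Real.log (Γ * A * Γ).det = 2 * Real.log Γ.det + Real.log A.det := fun A hA => by
    have hΓ0 := hΓ.det_pos.ne'
    rw [det_mul, det_mul, Real.log_mul (mul_ne_zero hΓ0 hA) hΓ0, Real.log_mul hΓ0 hA]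
    ring
  have hconj : α • (Γ * X * Γ) + (1 - α) • (Γ * Y * Γ) = Γ * (α • X + (1 - α) • Y) * Γ := by
    simp [Matrix.mul_add, Matrix.add_mul]
  have hconst : α * (1 - α) / 2 * (δ ^ 2 / (72 * Real.exp (1 / 2))) ≤ α * (1 - α) * δ ^ 2 := by
    have hexp : (1 : ℝ) ≤ Real.exp (1 / 2) := Real.one_le_exp (by norm_num)
    have hαβ := mul_nonneg hα0 hβ
    refine mul_le_mul (by linarith) (div_le_self (sq_nonneg δ) (by linarith)) (by positivity) hαβ
  rw [hconj, hlogdet _ hmix, hlogdet _ hX.det_pos.ne', hlogdet _ hY.det_pos.ne']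
  linarith
end

section
/- Let N be a positive integer, let Γ ∈ ℝ^{N×N} be symmetric strictly positive definite, let β, g, ε > 0 and set ρ = max_{i,j} |(Γ⁻¹ Γ⁻¹)_{i,j}|. Let K = {W ∈ ℝ^{N×N} : W symmetric strictly positive definite, max_{i,j} |W_{i,j}| ≤ β} and 𝓛 = {L ∈ ℝ^{N×N} : L symmetric positive semidefinite and ∑_{i,j} |L_{i,j}| ≤ g}. Define R(X) = −ln det(Γ X Γ + ε E) for X ∈ K, where E is the N×N identity matrix. Then R is s-strongly convex with respect to 𝓛 for K with s = 1/(1152 √e (β + ρε)² g²); that is, for all α ∈ [0,1], all X, Y ∈ K and all L ∈ 𝓛: R(αX + (1−α)Y) ≤ α R(X) + (1−α) R(Y) − (s/2) α(1−α) (L • (X − Y))². -/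
open Finset Matrix

/-- A second-order upper bound for the increment of the logarithm on `(0, M]`. -/
lemma log_sub_log_le_sub_sq {p z M : ℝ} (hp : 0 < p) (hz : 0 < z) (hpM : p ≤ M) (hzM : z ≤ M) :
    Real.log p - Real.log z ≤ (p - z) / z - (p - z) ^ 2 / (4 * M ^ 2) := by
  have hM : 0 < M := hp.trans_le hpM
  set a := √p
  set c := √z
  have ha : 0 < a := Real.sqrt_pos.2 hp
  have hc : 0 < c := Real.sqrt_pos.2 hz
  have hpa : p = a ^ 2 := (Real.sq_sqrt hp.le).symm
  have hzc : z = c ^ 2 := (Real.sq_sqrt hz.le).symm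
  have hlog : Real.log p - Real.log z = 2 * Real.log (a / c) := by
    rw [Real.log_div ha.ne' hc.ne', hpa, hzc, Real.log_pow, Real.log_pow]
    push_cast
    ring
  have hle : Real.log (a / c) ≤ a / c - 1 := Real.log_le_sub_one_of_pos (by positivity)
  have hsplit : (p - z) / z - 2 * (a / c - 1) = (a - c) ^ 2 / z := by
    rw [hpa, hzc]
    field_simp
    ring
  have hquad : (p - z) ^ 2 / (4 * M ^ 2) ≤ (a - c) ^ 2 / z := by
    rw [div_le_div_iff₀ (by positivity) hz]
    have hfac : (p - z) ^ 2 = (a - c) ^ 2 * (a + c) ^ 2 := by rw [hpa, hzc]; ring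
    have hsum : (a + c) ^ 2 ≤ 4 * M := by nlinarith [sq_nonneg (a - c)]
    calc (p - z) ^ 2 * z = (a - c) ^ 2 * ((a + c) ^ 2 * z) := by rw [hfac]; ring
      _ ≤ (a - c) ^ 2 * (4 * M * M) := by gcongr
      _ = (a - c) ^ 2 * (4 * M ^ 2) := by ring
  linarith

/-- Quantitative strong concavity of the logarithm on `(0, M]`. -/
lemma log_strong_concave {p q M α : ℝ} (hp : 0 < p) (hq : 0 < q) (hpM : p ≤ M) (hqM : q ≤ M)
    (h0 : 0 ≤ α) (h1 : α ≤ 1) :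
    α * Real.log p + (1 - α) * Real.log q + α * (1 - α) / 4 * ((p - q) / M) ^ 2
      ≤ Real.log (α * p + (1 - α) * q) := by
  have hM : 0 < M := hp.trans_le hpM
  set z := α * p + (1 - α) * q with hz_def
  have hz : 0 < z := (convex_Ioi (0 : ℝ)) hp hq h0 (sub_nonneg.2 h1) (by ring)
  have hzM : z ≤ M := (convex_Iic M) hpM hqM h0 (sub_nonneg.2 h1) (by ring)
  have hP := mul_le_mul_of_nonneg_left (log_sub_log_le_sub_sq hp hz hpM hzM) h0
  have hQ := mul_le_mul_of_nonneg_left (log_sub_log_le_sub_sq hq hz hqM hzM) (sub_nonneg.2 h1)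
  have hsum : α * ((p - z) / z - (p - z) ^ 2 / (4 * M ^ 2))
      + (1 - α) * ((q - z) / z - (q - z) ^ 2 / (4 * M ^ 2))
      = -(α * (1 - α) / 4 * ((p - q) / M) ^ 2) := by
    have hlin : α * ((p - z) / z) + (1 - α) * ((q - z) / z) = 0 := by
      field_simp
      rw [hz_def]
      ring
    have hquad : α * (p - z) ^ 2 + (1 - α) * (q - z) ^ 2 = α * (1 - α) * (p - q) ^ 2 := by
      rw [hz_def]
      ring
    calc _ = (α * ((p - z) / z) + (1 - α) * ((q - z) / z))
          - (α * (p - z) ^ 2 + (1 - α) * (q - z) ^ 2) / (4 * M ^ 2) := by ring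
      _ = _ := by
        rw [hlin, hquad]
        field_simp
        ring
  linarith

/-- A real positive definite matrix is orthogonally diagonalizable with positive eigenvalues. -/
lemma Matrix.PosDef.exists_orthogonal_diagonal {n : Type*} [Fintype n] [DecidableEq n]
    {A : Matrix n n ℝ} (hA : A.PosDef) :
    ∃ (V : Matrix n n ℝ) (d : n → ℝ), V * Vᵀ = 1 ∧ (∀ i, 0 < d i) ∧ A = V * diagonal d * Vᵀ := by
  refine ⟨hA.isHermitian.eigenvectorUnitary, hA.isHermitian.eigenvalues, ?_, hA.eigenvalues_pos, ?_⟩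
  · have h := Unitary.coe_mul_star_self hA.isHermitian.eigenvectorUnitary
    rwa [Unitary.coe_star, star_eq_conjTranspose, conjTranspose_eq_transpose_of_trivial] at h
  · have h := hA.isHermitian.spectral_theorem
    rw [Unitary.conjStarAlgAut_apply, star_eq_conjTranspose,
      conjTranspose_eq_transpose_of_trivial] at h
    exact h

/-- Two real positive definite matrices are simultaneously diagonalizable by congruence. -/
lemma Matrix.PosDef.exists_simultaneous_diagonal {n : Type*} [Fintype n] [DecidableEq n]
    {P Q : Matrix n n ℝ} (hP : P.PosDef) (hQ : Q.PosDef) :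
    ∃ (T : Matrix n n ℝ) (d : n → ℝ), T.det ≠ 0 ∧ (∀ i, 0 < d i) ∧
      P = T * Tᵀ ∧ Q = T * diagonal d * Tᵀ := by
  obtain ⟨V, v, hV, hv, hPV⟩ := hP.exists_orthogonal_diagonal
  set B := V * diagonal (fun i => √(v i))
  have hPB : P = B * Bᵀ := by
    have hsq : diagonal v = diagonal (fun i => √(v i)) * diagonal (fun i => √(v i)) := by
      rw [diagonal_mul_diagonal]
      congr 1
      ext i
      exact (Real.mul_self_sqrt (hv i).le).symm
    rw [hPV, hsq, transpose_mul, diagonal_transpose]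
    simp only [B, Matrix.mul_assoc]
  have hB : IsUnit B.det := by
    have h := hP.det_pos.ne'
    rw [hPB, det_mul] at h
    exact (left_ne_zero_of_mul h).isUnit
  have hC : (B⁻¹ * Q * B⁻¹ᵀ).PosDef := by
    have h := hQ.mul_mul_conjTranspose_same (B := B⁻¹)
      (vecMul_injective_of_isUnit ((isUnit_nonsing_inv_iff).2 ((isUnit_iff_isUnit_det B).2 hB)))
    rwa [conjTranspose_eq_transpose_of_trivial] at h
  obtain ⟨U, d, hU, hd, hCU⟩ := hC.exists_orthogonal_diagonal
  refine ⟨B * U, d, ?_, hd, ?_, ?_⟩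
  · rw [det_mul]
    have h : U.det * Uᵀ.det ≠ 0 := by rw [← det_mul, hU, det_one]; exact one_ne_zero
    exact mul_ne_zero hB.ne_zero (left_ne_zero_of_mul h)
  · rw [transpose_mul, Matrix.mul_assoc, ← Matrix.mul_assoc U, hU, Matrix.one_mul, hPB]
  · have hBT : B⁻¹ᵀ * Bᵀ = 1 := by
      rw [← transpose_mul, mul_nonsing_inv _ hB, transpose_one]
    calc Q = (B * B⁻¹) * Q * (B⁻¹ᵀ * Bᵀ) := by
          rw [hBT, mul_nonsing_inv _ hB, Matrix.one_mul, Matrix.mul_one]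
      _ = B * (B⁻¹ * Q * B⁻¹ᵀ) * Bᵀ := by simp only [Matrix.mul_assoc]
      _ = B * U * diagonal d * (B * U)ᵀ := by
          rw [hCU, transpose_mul B U]
          simp only [Matrix.mul_assoc]

lemma frob_mul_diagonal_mul_transpose {N : ℕ} (L T : Matrix (Fin N) (Fin N) ℝ) (w : Fin N → ℝ) :
    frob L (T * diagonal w * Tᵀ) = ∑ k, (Tᵀ * L * T) k k * w k := by
  calc frob L (T * diagonal w * Tᵀ) = (Lᵀ * (T * diagonal w * Tᵀ)).trace := by
        simp only [frob, trace, diag_apply, Matrix.mul_apply (M := Lᵀ), transpose_apply]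
        exact Finset.sum_comm
    _ = ((Lᵀ * (T * diagonal w * Tᵀ))ᵀ).trace := (trace_transpose _).symm
    _ = (T * diagonal w * (Tᵀ * L)).trace := by
        simp only [transpose_mul, transpose_transpose, diagonal_transpose, Matrix.mul_assoc]
    _ = (Tᵀ * L * T * diagonal w).trace := by
        rw [trace_mul_comm, Matrix.mul_assoc (Tᵀ * L)]
    _ = ∑ k, (Tᵀ * L * T) k k * w k := by
        simp only [trace, diag_apply, mul_diagonal]

lemma frob_le {N : ℕ} {L P : Matrix (Fin N) (Fin N) ℝ} {b g : ℝ} (hb : 0 ≤ b)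
    (hP : ∀ i j, |P i j| ≤ b) (hL : ∑ i, ∑ j, |L i j| ≤ g) : frob L P ≤ b * g := by
  calc frob L P ≤ ∑ i, ∑ j, |L i j| * b := by
        refine Finset.sum_le_sum fun i _ => Finset.sum_le_sum fun j _ => ?_
        exact (le_abs_self _).trans (by rw [abs_mul]; gcongr; exact hP i j)
    _ = b * ∑ i, ∑ j, |L i j| := by simp only [← Finset.sum_mul, mul_comm b]
    _ ≤ b * g := by gcongr

/-- Strong concavity of `log det` on positive definite matrices with bounded entries. -/
lemma log_det_strong_concave {N : ℕ} {P Q L : Matrix (Fin N) (Fin N) ℝ} {b g α : ℝ}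
    (hP : P.PosDef) (hQ : Q.PosDef) (hL : L.PosSemidef) (hb : 0 < b) (hg : 0 < g)
    (hPb : ∀ i j, |P i j| ≤ b) (hQb : ∀ i j, |Q i j| ≤ b) (hLg : ∑ i, ∑ j, |L i j| ≤ g)
    (h0 : 0 ≤ α) (h1 : α ≤ 1) :
    α * Real.log P.det + (1 - α) * Real.log Q.det
        + α * (1 - α) / (16 * b ^ 2 * g ^ 2) * frob L (P - Q) ^ 2
      ≤ Real.log (α • P + (1 - α) • Q).det := by
  obtain ⟨T, d, hT, hd, hPT, hQT⟩ := hP.exists_simultaneous_diagonal hQ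
  have hP1 : P = T * diagonal (fun _ => 1) * Tᵀ := by
    rw [diagonal_one, Matrix.mul_one, hPT]
  have hdiff : P - Q = T * diagonal (fun i => 1 - d i) * Tᵀ := by
    rw [← diagonal_sub, Matrix.mul_sub, Matrix.sub_mul, ← hP1, ← hQT]
  have hmix : α • P + (1 - α) • Q = T * diagonal (fun i => α * 1 + (1 - α) * d i) * Tᵀ := by
    rw [hP1, hQT, ← Matrix.smul_mul, ← Matrix.mul_smul, ← Matrix.smul_mul, ← Matrix.mul_smul,
      ← Matrix.add_mul, ← Matrix.mul_add, ← diagonal_smul, ← diagonal_smul, diagonal_add]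
    rfl
  have hlog : ∀ w : Fin N → ℝ, (∀ i, 0 < w i) →
      Real.log (T * diagonal w * Tᵀ).det = Real.log (T.det ^ 2) + ∑ i, Real.log (w i) := by
    intro w hw
    rw [det_mul, det_mul, det_transpose, det_diagonal, mul_right_comm, ← sq,
      Real.log_mul (pow_ne_zero 2 hT) (Finset.prod_pos fun i _ => hw i).ne',
      Real.log_prod fun i _ => (hw i).ne']
  have hmix_pos : ∀ i, 0 < α * 1 + (1 - α) * d i := fun i =>
    (convex_Ioi (0 : ℝ)) (Set.mem_Ioi.2 one_pos) (hd i) h0 (sub_nonneg.2 h1) (by ring)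
  set l : Fin N → ℝ := fun k => (Tᵀ * L * T) k k
  have hl : ∀ k, 0 ≤ l k := fun k => by
    have h := hL.conjTranspose_mul_mul_same T
    rw [conjTranspose_eq_transpose_of_trivial] at h
    exact h.diag_nonneg
  set S := ∑ i, ((1 - d i) / (1 + d i)) ^ 2 with hS
  have hS0 : 0 ≤ S := Finset.sum_nonneg fun i _ => sq_nonneg _
  have hweight : ∑ i, l i * (1 + d i) ≤ 2 * b * g := by
    have hlP := frob_le hb.le hPb hLg
    have hlQ := frob_le hb.le hQb hLg
    rw [hP1, frob_mul_diagonal_mul_transpose] at hlP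
    rw [hQT, frob_mul_diagonal_mul_transpose] at hlQ
    simp only [mul_add, Finset.sum_add_distrib]
    linarith
  have hfrob : frob L (P - Q) ^ 2 ≤ (2 * b * g) ^ 2 * S := by
    rw [hdiff, frob_mul_diagonal_mul_transpose]
    calc (∑ i, l i * (1 - d i)) ^ 2
        = (∑ i, l i * (1 + d i) * ((1 - d i) / (1 + d i))) ^ 2 := by
          congr 1
          refine Finset.sum_congr rfl fun i _ => ?_
          have := hd i
          field_simp
      _ ≤ (∑ i, (l i * (1 + d i)) ^ 2) * S := Finset.sum_mul_sq_le_sq_mul_sq _ _ _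
      _ ≤ (∑ i, l i * (1 + d i)) ^ 2 * S := by
          gcongr
          exact Finset.sum_sq_le_sq_sum_of_nonneg fun i _ =>
            mul_nonneg (hl i) (by linarith [hd i])
      _ ≤ (2 * b * g) ^ 2 * S := by
          gcongr
          exact Finset.sum_nonneg fun i _ => mul_nonneg (hl i) (by linarith [hd i])
  have hsum : (1 - α) * ∑ i, Real.log (d i) + α * (1 - α) / 4 * S
      ≤ ∑ i, Real.log (α * 1 + (1 - α) * d i) := by
    rw [hS, Finset.mul_sum, Finset.mul_sum, ← Finset.sum_add_distrib]
    refine Finset.sum_le_sum fun i _ => ?_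
    have h := log_strong_concave (M := 1 + d i) one_pos (hd i) (by linarith [hd i]) (by linarith)
      h0 h1
    simpa using h
  have hquad : α * (1 - α) / (16 * b ^ 2 * g ^ 2) * frob L (P - Q) ^ 2
      ≤ α * (1 - α) / 4 * S := by
    have hα : 0 ≤ α * (1 - α) := mul_nonneg h0 (sub_nonneg.2 h1)
    calc _ ≤ α * (1 - α) / (16 * b ^ 2 * g ^ 2) * ((2 * b * g) ^ 2 * S) := by gcongr
      _ = _ := by
        field_simp
        ring
  have hlogP : Real.log P.det = Real.log (T.det ^ 2) := by
    rw [hP1, hlog _ fun _ => one_pos]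
    simp
  rw [hmix, hlog _ hmix_pos, hlogP, hQT, hlog _ hd, ← hQT]
  linarith

theorem stmt5 (N : ℕ) (hN : 0 < N)
    (Γ : Matrix (Fin N) (Fin N) ℝ) (hΓ : Γ.PosDef)
    (β g ε ρ s : ℝ) (hβ : 0 < β) (hg : 0 < g) (hε : 0 < ε)
    (hρ : ρ = ⨆ i, ⨆ j, |(Γ⁻¹ * Γ⁻¹) i j|)
    (hs : s = 1 / (1152 * Real.sqrt (Real.exp 1) * (β + ρ * ε) ^ 2 * g ^ 2)) :
    ∀ α ∈ Set.Icc (0 : ℝ) 1, ∀ X Y : Matrix (Fin N) (Fin N) ℝ,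
      X.PosDef → (∀ i j, |X i j| ≤ β) → Y.PosDef → (∀ i j, |Y i j| ≤ β) →
      ∀ L : Matrix (Fin N) (Fin N) ℝ, L.PosSemidef → (∑ i, ∑ j, |L i j|) ≤ g →
      -Real.log ((Γ * (α • X + (1 - α) • Y) * Γ + ε • (1 : Matrix (Fin N) (Fin N) ℝ)).det)
        ≤ α * (-Real.log ((Γ * X * Γ + ε • (1 : Matrix (Fin N) (Fin N) ℝ)).det))
          + (1 - α) * (-Real.log ((Γ * Y * Γ + ε • (1 : Matrix (Fin N) (Fin N) ℝ)).det))
          - s / 2 * α * (1 - α) * (frob L (X - Y)) ^ 2 := by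
  rintro α ⟨h0, h1⟩ X Y hX hXβ hY hYβ L hL hLg
  have hdet : IsUnit Γ.det := hΓ.det_pos.ne'.isUnit
  set G := Γ⁻¹ * Γ⁻¹ with hG_def
  have hG : G.PosDef := by
    have h := (PosDef.one (n := Fin N) (R := ℝ)).mul_mul_conjTranspose_same (B := Γ⁻¹)
      (vecMul_injective_of_isUnit hΓ.inv.isUnit)
    rwa [hΓ.inv.isHermitian.eq, Matrix.mul_one] at h
  have hGρ : ∀ i j, |G i j| ≤ ρ := fun i j => by
    rw [hρ]
    exact (le_ciSup (f := fun j => |G i j|) (Set.finite_range _).bddAbove j).trans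
      (le_ciSup (f := fun i => ⨆ j, |G i j|) (Set.finite_range _).bddAbove i)
  have hρ0 : 0 ≤ ρ := (abs_nonneg _).trans (hGρ ⟨0, hN⟩ ⟨0, hN⟩)
  have hb : 0 < β + ρ * ε := by positivity
  have hfactor : ∀ W : Matrix (Fin N) (Fin N) ℝ,
      Γ * W * Γ + ε • (1 : Matrix (Fin N) (Fin N) ℝ) = Γ * (W + ε • G) * Γ := fun W => by
    have hone : Γ * G * Γ = 1 := by
      rw [hG_def, ← Matrix.mul_assoc, mul_nonsing_inv _ hdet, Matrix.one_mul,
        nonsing_inv_mul _ hdet]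
    rw [Matrix.mul_add, Matrix.add_mul, Matrix.mul_smul, Matrix.smul_mul, hone]
  have hlog : ∀ W : Matrix (Fin N) (Fin N) ℝ, (W + ε • G).PosDef →
      Real.log (Γ * W * Γ + ε • (1 : Matrix (Fin N) (Fin N) ℝ)).det
        = Real.log (Γ.det ^ 2) + Real.log (W + ε • G).det := fun W hW => by
    rw [hfactor, det_mul, det_mul, mul_right_comm, ← sq,
      Real.log_mul (pow_ne_zero 2 hdet.ne_zero) hW.det_pos.ne']
  have hpos : ∀ W : Matrix (Fin N) (Fin N) ℝ, W.PosSemidef → (W + ε • G).PosDef :=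
    fun W hW => PosDef.posSemidef_add hW (hG.smul hε)
  have hbound : ∀ W : Matrix (Fin N) (Fin N) ℝ, (∀ i j, |W i j| ≤ β) →
      ∀ i j, |(W + ε • G) i j| ≤ β + ρ * ε := fun W hW i j => by
    have hε' : |(ε • G) i j| ≤ ρ * ε := by
      rw [Matrix.smul_apply, smul_eq_mul, abs_mul, abs_of_pos hε, mul_comm]
      gcongr
      exact hGρ i j
    exact (abs_add_le _ _).trans (add_le_add (hW i j) hε')
  have hmix : α • (X + ε • G) + (1 - α) • (Y + ε • G) = α • X + (1 - α) • Y + ε • G := by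
    module
  have key := log_det_strong_concave (hpos X hX.posSemidef) (hpos Y hY.posSemidef) hL hb hg
    (hbound X hXβ) (hbound Y hYβ) hLg h0 h1
  rw [hmix, add_sub_add_right_eq_sub] at key
  have hs_le : s / 2 ≤ 1 / (16 * (β + ρ * ε) ^ 2 * g ^ 2) := by
    have hexp : 1 ≤ √(Real.exp 1) := Real.one_le_sqrt.2 (Real.one_le_exp zero_le_one)
    rw [hs, div_div]
    refine one_div_le_one_div_of_le (by positivity) ?_
    have hpos' : 0 < (β + ρ * ε) ^ 2 * g ^ 2 := by positivity
    nlinarith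
  have hquad : s / 2 * α * (1 - α) * frob L (X - Y) ^ 2
      ≤ α * (1 - α) / (16 * (β + ρ * ε) ^ 2 * g ^ 2) * frob L (X - Y) ^ 2 := by
    have hα : 0 ≤ α * (1 - α) := mul_nonneg h0 (sub_nonneg.2 h1)
    calc _ = s / 2 * (α * (1 - α) * frob L (X - Y) ^ 2) := by ring
      _ ≤ 1 / (16 * (β + ρ * ε) ^ 2 * g ^ 2) * (α * (1 - α) * frob L (X - Y) ^ 2) := by gcongr
      _ = _ := by ring
  rw [hlog _ (hpos _ ((hX.posSemidef.smul h0).add (hY.posSemidef.smul (sub_nonneg.2 h1)))),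
    hlog _ (hpos X hX.posSemidef), hlog _ (hpos Y hY.posSemidef)]
  linarith
end

section
/- Let N be a positive integer, let Γ ∈ ℝ^{N×N} be symmetric strictly positive definite, and let ε, τ > 0. Let W, W' ∈ ℝ^{N×N} be symmetric positive semidefinite matrices with Tr(Γ W' Γ) ≤ τ. Then ln det(Γ W' Γ + ε E) − ln det(Γ W Γ + ε E) ≤ τ / ε, where E is the N×N identity matrix. Equivalently, the range of the generalised log-determinant regularizer R(W) = −ln det(Γ W Γ + ε E) over any set of symmetric positive semidefinite matrices with Γ-trace Tr(ΓWΓ) at most τ has diameter at most τ/ε. -/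
open Matrix

theorem Matrix.IsHermitian.det_add_smul_one {n : Type*} [Fintype n] [DecidableEq n]
    {A : Matrix n n ℝ} (hA : A.IsHermitian) (ε : ℝ) :
    (A + ε • (1 : Matrix n n ℝ)).det = ∏ i, (hA.eigenvalues i + ε) := by
  have h := congrArg (Polynomial.eval (-ε)) hA.charpoly_eq
  rw [Matrix.eval_charpoly, Polynomial.eval_prod] at h
  have hneg : A + ε • (1 : Matrix n n ℝ) = -(scalar n (-ε) - A) := by
    simp [smul_one_eq_diagonal, ← diagonal_neg]
  rw [hneg, det_neg, h, ← Finset.card_univ, ← Finset.prod_const, ← Finset.prod_mul_distrib]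
  refine Finset.prod_congr rfl fun i _ => ?_
  simp

theorem Matrix.PosSemidef.log_det_add_smul_one {n : Type*} [Fintype n] [DecidableEq n]
    {A : Matrix n n ℝ} (hA : A.PosSemidef) {ε : ℝ} (hε : 0 < ε) :
    Real.log (A + ε • (1 : Matrix n n ℝ)).det =
      ∑ i, Real.log (hA.isHermitian.eigenvalues i + ε) := by
  rw [hA.isHermitian.det_add_smul_one, Real.log_prod]
  exact fun i _ => (add_pos_of_nonneg_of_pos (hA.eigenvalues_nonneg i) hε).ne'

theorem Matrix.PosSemidef.card_mul_log_le_log_det {n : Type*} [Fintype n] [DecidableEq n]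
    {A : Matrix n n ℝ} (hA : A.PosSemidef) {ε : ℝ} (hε : 0 < ε) :
    Fintype.card n * Real.log ε ≤ Real.log (A + ε • (1 : Matrix n n ℝ)).det := by
  rw [hA.log_det_add_smul_one hε, ← nsmul_eq_mul, ← Finset.card_univ, ← Finset.sum_const]
  exact Finset.sum_le_sum fun i _ =>
    Real.log_le_log hε (le_add_of_nonneg_left (hA.eigenvalues_nonneg i))

theorem Matrix.PosSemidef.log_det_le_card_mul_log_add {n : Type*} [Fintype n] [DecidableEq n]
    {A : Matrix n n ℝ} (hA : A.PosSemidef) {ε : ℝ} (hε : 0 < ε) :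
    Real.log (A + ε • (1 : Matrix n n ℝ)).det ≤
      Fintype.card n * Real.log ε + A.trace / ε := by
  have htr : A.trace = ∑ i, hA.isHermitian.eigenvalues i := by
    simpa using hA.isHermitian.trace_eq_sum_eigenvalues
  rw [hA.log_det_add_smul_one hε, htr, ← nsmul_eq_mul, ← Finset.card_univ, ← Finset.sum_const,
    Finset.sum_div, ← Finset.sum_add_distrib]
  refine Finset.sum_le_sum fun i _ => ?_
  have hpos := add_pos_of_nonneg_of_pos (hA.eigenvalues_nonneg i) hε
  have hlog := Real.log_le_sub_one_of_pos (div_pos hpos hε)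
  rw [Real.log_div hpos.ne' hε.ne', add_div, div_self hε.ne'] at hlog
  linarith

theorem stmt6 (N : ℕ) (hN : 0 < N)
    (Γ : Matrix (Fin N) (Fin N) ℝ) (hΓ : Γ.PosDef)
    (ε τ : ℝ) (hε : 0 < ε) (hτ : 0 < τ)
    (W W' : Matrix (Fin N) (Fin N) ℝ) (hW : W.PosSemidef) (hW' : W'.PosSemidef)
    (htr : (Γ * W' * Γ).trace ≤ τ) :
    Real.log ((Γ * W' * Γ + ε • (1 : Matrix (Fin N) (Fin N) ℝ)).det)
      - Real.log ((Γ * W * Γ + ε • (1 : Matrix (Fin N) (Fin N) ℝ)).det) ≤ τ / ε := by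
  have hconj {V : Matrix (Fin N) (Fin N) ℝ} (hV : V.PosSemidef) : (Γ * V * Γ).PosSemidef := by
    simpa only [hΓ.isHermitian.eq] using hV.mul_mul_conjTranspose_same Γ
  have hlower := (hconj hW).card_mul_log_le_log_det hε
  have hupper := (hconj hW').log_det_le_card_mul_log_add hε
  have hdiv : (Γ * W' * Γ).trace / ε ≤ τ / ε := div_le_div_of_nonneg_right htr hε.le
  linarith
end

section
/- Let m, n, d, T be positive integers and γ > 0. For t ∈ [T], let (i_t, j_t, y_t) ∈ [m] × [n] × {−1, 1}, let X_t ∈ ℝ^{m×n}, and let ŷ_t = 1 if X_{t,(i_t,j_t)} ≥ 0 and ŷ_t = −1 otherwise. Let M = |{t ∈ [T] : ŷ_t ≠ y_t}|. Then for all matrices P ∈ ℝ^{m×d} and Q ∈ ℝ^{n×d} all of whose rows are nonzero, M ≤ ∑_{t : ŷ_t ≠ y_t} ( h_γ(y_t X_{t,(i_t,j_t)}) − h_γ(y_t (P̄ Q̄ᵀ)_{i_t, j_t}) ) + ∑_{t=1}^{T} h_γ( y_t ⟨P_{i_t}, Q_{j_t}⟩ / (‖P_{i_t}‖₂ ‖Q_{j_t}‖₂)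 ). -/
open Finset Matrix

/-- The hinge loss at margin `γ`: `h_γ(x) = 0` if `x ≥ γ` and `1 - x/γ` otherwise. -/
noncomputable def hinge (γ x : ℝ) : ℝ := if γ ≤ x then 0 else 1 - x / γ

/-- Euclidean norm of a vector in `ℝ^d`. -/
noncomputable def e2norm {d : ℕ} (v : Fin d → ℝ) : ℝ := Real.sqrt (∑ k, v k ^ 2)

/-- Row-normalised version of a matrix: each row is divided by its Euclidean norm. -/
noncomputable def rowNormalize {m d : ℕ} (A : Matrix (Fin m) (Fin d) ℝ) :
    Matrix (Fin m) (Fin d) ℝ :=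
  fun i j => A i j / e2norm (A i)

theorem hinge_nonneg {γ : ℝ} (hγ : 0 < γ) (x : ℝ) : 0 ≤ hinge γ x := by
  unfold hinge
  split_ifs with h
  · exact le_rfl
  · exact sub_nonneg.2 ((div_le_one hγ).2 (not_le.1 h).le)

theorem one_le_hinge {γ x : ℝ} (hγ : 0 < γ) (hx : x ≤ 0) : 1 ≤ hinge γ x := by
  rw [hinge, if_neg (not_le.2 (hx.trans_lt hγ))]
  linarith [div_nonpos_of_nonpos_of_nonneg hx hγ.le]

theorem rowNormalize_mul_transpose_apply {m n d : ℕ} (P : Matrix (Fin m) (Fin d) ℝ)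
    (Q : Matrix (Fin n) (Fin d) ℝ) (i : Fin m) (j : Fin n) :
    (rowNormalize P * (rowNormalize Q)ᵀ) i j = (P i ⬝ᵥ Q j) / (e2norm (P i) * e2norm (Q j)) := by
  simp only [Matrix.mul_apply, Matrix.transpose_apply, rowNormalize, dotProduct, Finset.sum_div,
    div_mul_div_comm]

theorem stmt7 (m n d T : ℕ) (hm : 0 < m) (hn : 0 < n) (hd : 0 < d) (hT : 0 < T)
    (γ : ℝ) (hγ : 0 < γ)
    (it : Fin T → Fin m) (jt : Fin T → Fin n)
    (y : Fin T → ℝ) (hy : ∀ t, y t = 1 ∨ y t = -1)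
    (X : Fin T → Matrix (Fin m) (Fin n) ℝ)
    (yhat : Fin T → ℝ)
    (hyhat : ∀ t, yhat t = if 0 ≤ X t (it t) (jt t) then 1 else -1)
    (P : Matrix (Fin m) (Fin d) ℝ) (Q : Matrix (Fin n) (Fin d) ℝ)
    (hP : ∀ i, P i ≠ 0) (hQ : ∀ j, Q j ≠ 0) :
    ((Finset.univ.filter (fun t => yhat t ≠ y t)).card : ℝ)
      ≤ (∑ t ∈ Finset.univ.filter (fun t => yhat t ≠ y t),
          (hinge γ (y t * X t (it t) (jt t))
            - hinge γ (y t * (rowNormalize P * (rowNormalize Q)ᵀ) (it t) (jt t))))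
        + ∑ t, hinge γ (y t * (P (it t) ⬝ᵥ Q (jt t))
            / (e2norm (P (it t)) * e2norm (Q (jt t)))) := by
  simp only [rowNormalize_mul_transpose_apply, ← mul_div_assoc]
  rw [Finset.sum_sub_distrib]
  have hcard : ((Finset.univ.filter (fun t => yhat t ≠ y t)).card : ℝ)
      ≤ ∑ t ∈ Finset.univ.filter (fun t => yhat t ≠ y t),
          hinge γ (y t * X t (it t) (jt t)) := by
    rw [← nsmul_one]
    refine Finset.card_nsmul_le_sum _ _ _ fun t ht => one_le_hinge hγ ?_
    have hne := (Finset.mem_filter.1 ht).2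
    rw [hyhat] at hne
    split_ifs at hne with h <;> rcases hy t with h1 | h1 <;> simp [h1] at hne ⊢ <;> linarith
  have hsub := Finset.sum_le_sum_of_subset_of_nonneg
    (Finset.filter_subset (fun t => yhat t ≠ y t) Finset.univ)
    fun t _ _ => hinge_nonneg hγ (y t * (P (it t) ⬝ᵥ Q (jt t))
      / (e2norm (P (it t)) * e2norm (Q (jt t))))
  linarith
end

section
/- Let N be a positive integer and let p, q be probability density functions on ℝ^N such that x ↦ p(x) ln p(x) and x ↦ q(x) ln q(x) are integrable. Let δ = (1/2) ∫_{ℝ^N} |p(x) − q(x)| dx and let α ∈ [0,1]. Then ∫_{ℝ^N} (α p(x) + (1−α) q(x)) ln(α p(x) + (1−α) q(x)) dx ≤ α ∫_{ℝ^N} p(x) ln p(x) dx + (1−α) ∫_{ℝ^N} q(x) ln q(x) dx − α(1−α) δ². -/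
open MeasureTheory

/-- A pointwise Pinsker-type bound: comparing relative entropy with the Hellinger distance and
then applying the AM-GM inequality with weight `s`. -/
lemma sub_add_mul_abs_sub_le_mul_log_sub_mul_log {a m : ℝ} (ha : 0 ≤ a) (hm : 0 ≤ m)
    (ham : m = 0 → a = 0) (s : ℝ) :
    a - m + 2 * s * |a - m| - 2 * s ^ 2 * (a + m) ≤ a * Real.log a - a * Real.log m := by
  obtain ⟨x, hx, rfl⟩ : ∃ x, 0 ≤ x ∧ x ^ 2 = a := ⟨√a, Real.sqrt_nonneg a, Real.sq_sqrt ha⟩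
  obtain ⟨y, hy, rfl⟩ : ∃ y, 0 ≤ y ∧ y ^ 2 = m := ⟨√m, Real.sqrt_nonneg m, Real.sq_sqrt hm⟩
  have hellinger : 2 * x ^ 2 - 2 * (x * y) ≤
      x ^ 2 * Real.log (x ^ 2) - x ^ 2 * Real.log (y ^ 2) := by
    rcases hx.eq_or_lt with rfl | hx
    · simp
    have hy : 0 < y := hy.lt_of_ne' fun h => by simp [h, hx.ne'] at ham
    have key := Real.log_le_sub_one_of_pos (div_pos hy hx)
    rw [Real.log_div hy.ne' hx.ne'] at key
    have := mul_le_mul_of_nonneg_left key (by positivity : 0 ≤ 2 * x ^ 2)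
    have e : 2 * x ^ 2 * (y / x - 1) = 2 * (x * y) - 2 * x ^ 2 := by field_simp
    rw [Real.log_pow, Real.log_pow]
    push_cast
    linarith
  have habs : |x ^ 2 - y ^ 2| = |x - y| * (x + y) := by
    rw [sq_sub_sq, abs_mul, abs_of_nonneg (add_nonneg hx hy), mul_comm]
  rw [habs]
  nlinarith [sq_nonneg (|x - y| - s * (x + y)), sq_abs (x - y),
    mul_nonneg (sq_nonneg s) (sq_nonneg (x - y))]

lemma mul_log_add_mul_log_le {a b : ℝ} (ha : 0 ≤ a) (hb : 0 ≤ b) :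
    a * Real.log a + b * Real.log b ≤ (a + b) * Real.log (a + b) := by
  rcases ha.eq_or_lt with rfl | ha
  · simp
  rcases hb.eq_or_lt with rfl | hb
  · simp
  rw [add_mul]
  gcongr <;> linarith

lemma mul_mul_log_mul (c a : ℝ) :
    (c * a) * Real.log (c * a) = c * Real.log c * a + c * (a * Real.log a) := by
  rcases eq_or_ne c 0 with rfl | hc
  · simp
  rcases eq_or_ne a 0 with rfl | ha
  · simp
  rw [Real.log_mul hc ha]
  ring

/-- A quantitative form of the convexity of `x ↦ x * log x`, with a free parameter `d`. -/
lemma mix_mul_log_mix_le {a b α : ℝ} (ha : 0 ≤ a) (hb : 0 ≤ b) (hα : α ∈ Set.Icc (0 : ℝ) 1)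
    (d : ℝ) :
    (α * a + (1 - α) * b) * Real.log (α * a + (1 - α) * b) ≤
      α * (a * Real.log a) + (1 - α) * (b * Real.log b) - α * (1 - α) * d * |a - b|
        + α * (1 - α) ^ 2 * d ^ 2 / 2 * (a + (α * a + (1 - α) * b))
        + (1 - α) * α ^ 2 * d ^ 2 / 2 * (b + (α * a + (1 - α) * b)) := by
  obtain ⟨h0, h1⟩ := hα
  rcases h0.eq_or_lt with rfl | h0
  · simp
  rcases h1.eq_or_lt with rfl | h1
  · simp
  have h1' : 0 < 1 - α := sub_pos.2 h1
  set m := α * a + (1 - α) * b with hm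
  have hαa : 0 ≤ α * a := by positivity
  have hαb : 0 ≤ (1 - α) * b := by positivity
  have hm0 : 0 ≤ m := add_nonneg hαa hαb
  have hma : m = 0 → a = 0 := fun h => by
    have : α * a = 0 := by linarith
    simpa [h0.ne'] using this
  have hmb : m = 0 → b = 0 := fun h => by
    have : (1 - α) * b = 0 := by linarith
    simpa [h1'.ne'] using this
  have A := sub_add_mul_abs_sub_le_mul_log_sub_mul_log ha hm0 hma ((1 - α) * d / 2)
  have B := sub_add_mul_abs_sub_le_mul_log_sub_mul_log hb hm0 hmb (α * d / 2)
  have ea : |a - m| = (1 - α) * |a - b| := by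
    rw [show a - m = (1 - α) * (a - b) by rw [hm]; ring, abs_mul, abs_of_pos h1']
  have eb : |b - m| = α * |a - b| := by
    rw [abs_sub_comm, show m - b = α * (a - b) by rw [hm]; ring, abs_mul, abs_of_pos h0]
  rw [ea] at A
  rw [eb] at B
  have A' := mul_le_mul_of_nonneg_left A h0.le
  have B' := mul_le_mul_of_nonneg_left B h1'.le
  have em : m * Real.log m = α * a * Real.log m + (1 - α) * b * Real.log m := by
    rw [← add_mul]
  have e0 : α * (a - m) + (1 - α) * (b - m) = 0 := by rw [hm]; ring
  linear_combination A' + B' + em + e0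

theorem stmt12 (N : ℕ) (hN : 0 < N)
    (p q : (Fin N → ℝ) → ℝ)
    (hp0 : ∀ x, 0 ≤ p x) (hq0 : ∀ x, 0 ≤ q x)
    (hpInt : Integrable p) (hqInt : Integrable q)
    (hp1 : (∫ x, p x) = 1) (hq1 : (∫ x, q x) = 1)
    (hpl : Integrable (fun x => p x * Real.log (p x)))
    (hql : Integrable (fun x => q x * Real.log (q x)))
    (δ α : ℝ) (hδ : δ = (1 / 2) * ∫ x, |p x - q x|)
    (hα : α ∈ Set.Icc (0 : ℝ) 1) :
    (∫ x, (α * p x + (1 - α) * q x) * Real.log (α * p x + (1 - α) * q x))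
      ≤ α * (∫ x, p x * Real.log (p x)) + (1 - α) * (∫ x, q x * Real.log (q x))
        - α * (1 - α) * δ ^ 2 := by
  have hα' : 0 ≤ 1 - α := sub_nonneg.2 hα.2
  have hd : Integrable fun x => |p x - q x| := (hpInt.sub hqInt).abs
  have hmInt : Integrable fun x => α * p x + (1 - α) * q x :=
    (hpInt.const_mul α).add (hqInt.const_mul (1 - α))
  have hm1 : (∫ x, α * p x + (1 - α) * q x) = 1 := by
    rw [integral_add (hpInt.const_mul α) (hqInt.const_mul (1 - α)), integral_const_mul,
      integral_const_mul, hp1, hq1]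
    ring
  have i1 := hpl.const_mul α
  have i2 := hql.const_mul (1 - α)
  have i3 := hd.const_mul (α * (1 - α) * δ)
  have i4 := (hpInt.add hmInt).const_mul (α * (1 - α) ^ 2 * δ ^ 2 / 2)
  have i5 := (hqInt.add hmInt).const_mul ((1 - α) * α ^ 2 * δ ^ 2 / 2)
  simp only [Pi.add_apply] at i4 i5
  have hupper := (((i1.add i2).sub i3).add i4).add i5
  have hlower := ((hpInt.const_mul (α * Real.log α)).add i1).add
    ((hqInt.const_mul ((1 - α) * Real.log (1 - α))).add i2)
  have hle x := mix_mul_log_mix_le (hp0 x) (hq0 x) hα δ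
  have hInt : Integrable fun x =>
      (α * p x + (1 - α) * q x) * Real.log (α * p x + (1 - α) * q x) := by
    refine integrable_of_le_of_le
      (Real.continuous_mul_log.comp_aestronglyMeasurable hmInt.aestronglyMeasurable)
      (.of_forall fun x => ?_) (.of_forall hle) hlower hupper
    have := mul_log_add_mul_log_le (mul_nonneg hα.1 (hp0 x)) (mul_nonneg hα' (hq0 x))
    rw [mul_mul_log_mul α, mul_mul_log_mul (1 - α)] at this
    exact this
  have hmono := integral_mono hInt hupper hle
  refine hmono.trans (le_of_eq ?_)
  have hL : (∫ x, |p x - q x|) = 2 * δ := by linarith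
  rw [integral_add' (((i1.add i2).sub i3).add i4) i5, integral_add' ((i1.add i2).sub i3) i4,
    integral_sub' (i1.add i2) i3, integral_add' i1 i2]
  simp only [integral_const_mul]
  rw [integral_add hpInt hmInt, integral_add hqInt hmInt, hL, hp1, hq1, hm1]
  ring
end

section
/- For every real number x with 0 ≤ x ≤ 1/2, e^{−x/2} − e^{−(1−x)/2} ≥ (e^{−1/4}/2)(1 − 2x). -/
theorem stmt14 (x : ℝ) (hx0 : 0 ≤ x) (hx : x ≤ 1 / 2) :
    Real.exp (-1 / 4) / 2 * (1 - 2 * x) ≤ Real.exp (-x / 2) - Real.exp (-(1 - x) / 2) := by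
  have h : (1 - 2 * x) / 4 ≤ Real.sinh ((1 - 2 * x) / 4) :=
    Real.self_le_sinh_iff.2 (by linarith)
  have key : Real.exp (-x / 2) - Real.exp (-(1 - x) / 2) =
      2 * Real.exp (-1 / 4) * Real.sinh ((1 - 2 * x) / 4) := by
    rw [show -x / 2 = -1 / 4 + (1 - 2 * x) / 4 by ring,
      show -(1 - x) / 2 = -1 / 4 + -((1 - 2 * x) / 4) by ring,
      Real.exp_add, Real.exp_add, Real.sinh_eq]
    ring
  calc Real.exp (-1 / 4) / 2 * (1 - 2 * x)
      = 2 * Real.exp (-1 / 4) * ((1 - 2 * x) / 4) := by ring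
    _ ≤ 2 * Real.exp (-1 / 4) * Real.sinh ((1 - 2 * x) / 4) := by gcongr
    _ = Real.exp (-x / 2) - Real.exp (-(1 - x) / 2) := key.symm
end

section
/- Let N be a positive integer, β' > 0, g > 0. Let X, Y ∈ ℝ^{N×N} be symmetric strictly positive definite matrices with |X_{i,i}| ≤ β' and |Y_{i,i}| ≤ β' for all i ∈ [N], and let L ∈ ℝ^{N×N} be symmetric positive semidefinite with ∑_{i,j} |L_{i,j}| ≤ g. Then there exist indices i, j ∈ [N] such that |X_{i,j} − Y_{i,j}| ≥ (|L • (X − Y)| / (4 β' g)) · (X_{i,i} + Y_{i,i} + X_{j,j} + Y_{j,j}). -/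
open Finset Matrix

/-- Hölder's inequality for the Frobenius inner product, with the entrywise `ℓ¹` and `ℓ^∞` norms. -/
theorem abs_frob_le_sum_abs_mul {N : ℕ} (A B : Matrix (Fin N) (Fin N) ℝ) {c : ℝ}
    (hB : ∀ i j, |B i j| ≤ c) : |frob A B| ≤ (∑ i, ∑ j, |A i j|) * c := by
  simp only [frob, sum_mul]
  refine (abs_sum_le_sum_abs _ _).trans (sum_le_sum fun i _ => ?_)
  refine (abs_sum_le_sum_abs _ _).trans (sum_le_sum fun j _ => ?_)
  rw [abs_mul]
  exact mul_le_mul_of_nonneg_left (hB i j) (abs_nonneg _)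

theorem stmt15 (N : ℕ) (hN : 0 < N) (β' g : ℝ) (hβ' : 0 < β') (hg : 0 < g)
    (X Y : Matrix (Fin N) (Fin N) ℝ) (hX : X.PosDef) (hY : Y.PosDef)
    (hXd : ∀ i, |X i i| ≤ β') (hYd : ∀ i, |Y i i| ≤ β')
    (L : Matrix (Fin N) (Fin N) ℝ) (hL : L.PosSemidef)
    (hL1 : (∑ i, ∑ j, |L i j|) ≤ g) :
    ∃ i j, |frob L (X - Y)| / (4 * β' * g) * (X i i + Y i i + X j j + Y j j)
      ≤ |X i j - Y i j| := by
  have : Nonempty (Fin N) := ⟨⟨0, hN⟩⟩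
  obtain ⟨⟨i, j⟩, hmax⟩ := Finite.exists_max fun p : Fin N × Fin N => |(X - Y) p.1 p.2|
  refine ⟨i, j, ?_⟩
  have hfrob : |frob L (X - Y)| ≤ |X i j - Y i j| * g := by
    rw [mul_comm]
    exact (abs_frob_le_sum_abs_mul L (X - Y) fun k l => hmax (k, l)).trans
      (mul_le_mul_of_nonneg_right hL1 (abs_nonneg _))
  have hdiag : X i i + Y i i + X j j + Y j j ≤ 4 * β' := by
    linarith [le_of_abs_le (hXd i), le_of_abs_le (hYd i), le_of_abs_le (hXd j),
      le_of_abs_le (hYd j)]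
  calc |frob L (X - Y)| / (4 * β' * g) * (X i i + Y i i + X j j + Y j j)
      ≤ |frob L (X - Y)| / (4 * β' * g) * (4 * β') := by gcongr
    _ = |frob L (X - Y)| / g := by field_simp
    _ ≤ |X i j - Y i j| := (div_le_iff₀ hg).2 hfrob
end
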